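/- Let 0 < α < 1. There exists an integer j₀ such that for all smooth f, g: 𝕋² → ℝ, the high–high part T_{HH}[f,g] = Σ_{j ∈ ℤ} T[Δ_j f, (S_{j+j₀−1} − S_{j−j₀})g] of the bilinear operator T[f,g] = Λ^{−1}((Λf)g − f(Λg)) satisfies ‖Δ_l T_{HH}[f,g]‖₀ ≲ 2^{−lα} ‖f‖_α ‖g‖_α for every l ∈ ℤ, and hence ‖T_{HH}[f,g]‖_α ≲ ‖f‖_α ‖g‖_α, with implicit constants depending only on α. -/

import Mathlib

/-!
Common setup: functions on the torus `𝕋^d = ℝ^d/(2πℤ)^d` are modelled as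
`2π`-periodic functions on `ℝ^d = Fin d → ℝ`, with Fourier coefficients,
Fourier multiplier operators, Hölder norms, etc.
-/

noncomputable section

open scoped BigOperators
open MeasureTheory

/-- Points of `ℝ^d` (covering the torus `𝕋^d = ℝ^d/(2πℤ)^d`). -/
abbrev Vd (d : ℕ) := Fin d → ℝ

/-- The lattice vector `2π m`. -/
def latt {d : ℕ} (m : Fin d → ℤ) : Vd d := fun i => 2 * Real.pi * (m i : ℝ)

/-- `f` is `2π`-periodic in each coordinate, i.e. a function on the torus `𝕋^d`. -/
def TorusFun {d : ℕ} {F : Type*} (f : Vd d → F) : Prop :=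
  ∀ (x : Vd d) (m : Fin d → ℤ), f (x + latt m) = f x

/-- Dot product of an integer frequency with a point of `ℝ^d`. -/
def dotZ {d : ℕ} (k : Fin d → ℤ) (x : Vd d) : ℝ := ∑ i, (k i : ℝ) * x i

/-- The Euclidean norm on `ℝ^d`. -/
def eNorm {d : ℕ} (x : Vd d) : ℝ := Real.sqrt (∑ i, (x i) ^ 2)

/-- `|k|` for an integer frequency `k ∈ ℤ^d`. -/
def kAbs {d : ℕ} (k : Fin d → ℤ) : ℝ := eNorm (fun i => (k i : ℝ))

/-- The fundamental domain `[0,2π]^d`. -/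
def box (d : ℕ) : Set (Vd d) := Set.Icc 0 (fun _ => 2 * Real.pi)

/-- Mean-zero (real-valued) function on the torus. -/
def MeanZeroR {d : ℕ} (f : Vd d → ℝ) : Prop := ∫ x in box d, f x = 0

/-- Fourier coefficient `f̂(k)` of a function on the torus. -/
def fCoeff {d : ℕ} (f : Vd d → ℂ) (k : Fin d → ℤ) : ℂ :=
  (((2 * Real.pi) ^ d)⁻¹ : ℝ) • ∫ x in box d, f x * Complex.exp (-(Complex.I * (dotZ k x : ℂ)))

/-- Fourier multiplier operator with symbol `m : ℤ^d → ℂ`. -/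
def fmul {d : ℕ} (m : (Fin d → ℤ) → ℂ) (f : Vd d → ℂ) : Vd d → ℂ :=
  fun x => ∑' k : Fin d → ℤ, m k * fCoeff f k * Complex.exp (Complex.I * (dotZ k x : ℂ))

/-- `Λ^s = (-Δ)^{s/2}`: Fourier multiplier with symbol `|k|^s` (acting on mean-zero parts). -/
def LamPow {d : ℕ} (s : ℝ) : (Vd d → ℂ) → Vd d → ℂ :=
  fmul (fun k => if k = 0 then 0 else (((kAbs k) ^ s : ℝ) : ℂ))

/-- `Λ = (-Δ)^{1/2}`. -/
def Lam1 {d : ℕ} : (Vd d → ℂ) → Vd d → ℂ := LamPow 1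

/-- `i`-th component of the SQG operator `∇^⊥Λ^{-1} = (-∂₂Λ^{-1}, ∂₁Λ^{-1})`,
with symbols `(-i k₂/|k|, i k₁/|k|)`. -/
def sqgOp (i : Fin 2) : (Vd 2 → ℂ) → Vd 2 → ℂ :=
  fmul (fun k => if k = 0 then 0 else
    (if i = 0 then -(Complex.I * (k 1 : ℂ)) else Complex.I * (k 0 : ℂ)) / ((kAbs k : ℝ) : ℂ))

/-- First-order partial derivative `∂_i`. -/
def pd {d : ℕ} {F : Type*} [NormedAddCommGroup F] [NormedSpace ℝ F]
    (i : Fin d) (f : Vd d → F) (x : Vd d) : F :=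
  fderiv ℝ f x (Pi.single i 1)

/-- Complexification of a real-valued function. -/
def cplx {d : ℕ} (f : Vd d → ℝ) : Vd d → ℂ := fun x => (f x : ℂ)

/-- The `C^N` norm: sum of sup-norms of the iterated derivatives of order `≤ N`. -/
def CkNorm {d : ℕ} {F : Type*} [NormedAddCommGroup F] [NormedSpace ℝ F]
    (N : ℕ) (f : Vd d → F) : ℝ :=
  ∑ n ∈ Finset.range (N + 1), ⨆ x : Vd d, ‖iteratedFDeriv ℝ n f x‖

/-- The `α`-Hölder seminorm. -/
def hSemi {d : ℕ} {F : Type*} [NormedAddCommGroup F] (α : ℝ) (f : Vd d → F) : ℝ :=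
  ⨆ p : Vd d × Vd d, if p.1 = p.2 then 0 else ‖f p.1 - f p.2‖ / ‖p.1 - p.2‖ ^ α

/-- The `C^{N,α}` Hölder norm `‖f‖_{N+α}`. -/
def HolNorm {d : ℕ} {F : Type*} [NormedAddCommGroup F] [NormedSpace ℝ F]
    (N : ℕ) (α : ℝ) (f : Vd d → F) : ℝ :=
  CkNorm N f + hSemi α (iteratedFDeriv ℝ N f)

/-- `∇^⊥·div R` for a `2`-tensor field `R` on `ℝ²` (values in any normed space). -/
def perpDivDiv {F : Type*} [NormedAddCommGroup F] [NormedSpace ℝ F]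
    (R : Vd 2 → Fin 2 → Fin 2 → F) (x : Vd 2) : F :=
  - pd 1 (fun y => ∑ j, pd j (fun z => R z 0 j) y) x
  + pd 0 (fun y => ∑ j, pd j (fun z => R z 1 j) y) x

/-- Material derivative `D_t f = ∂_t f + u·∇f`. -/
def matD (u : ℝ → Vd 2 → Fin 2 → ℝ) (f : ℝ → Vd 2 → ℝ) (t : ℝ) (x : Vd 2) : ℝ :=
  deriv (fun s => f s x) t + ∑ i, u t x i * pd i (f t) x

/-- The SQG–Reynolds system `∂_tθ + u·∇θ = ∇^⊥·div R`, `u = ∇^⊥Λ^{-1}θ`,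
for smooth space-periodic data with `R` symmetric. -/
structure SQGReynolds (θ : ℝ → Vd 2 → ℝ) (u : ℝ → Vd 2 → Fin 2 → ℝ)
    (R : ℝ → Vd 2 → Fin 2 → Fin 2 → ℝ) : Prop where
  smooth_θ : ContDiff ℝ (⊤ : ℕ∞) fun p : ℝ × Vd 2 => θ p.1 p.2
  smooth_u : ContDiff ℝ (⊤ : ℕ∞) fun p : ℝ × Vd 2 => u p.1 p.2
  smooth_R : ContDiff ℝ (⊤ : ℕ∞) fun p : ℝ × Vd 2 => R p.1 p.2
  periodic_θ : ∀ t, TorusFun (θ t)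
  periodic_u : ∀ t, TorusFun (u t)
  periodic_R : ∀ t, TorusFun (R t)
  symm_R : ∀ t x i j, R t x i j = R t x j i
  vel : ∀ t x i, (u t x i : ℂ) = sqgOp i (cplx (θ t)) x
  eqn : ∀ t x, matD u θ t x = perpDivDiv (R t) x

/-- The bilinear operator `T[f,g] = Λ^{-1}((Λf)g - f(Λg))`. -/
def Tbil (f g : Vd 2 → ℂ) : Vd 2 → ℂ :=
  LamPow (-1) (fun x => Lam1 f x * g x - f x * Lam1 g x)

/-- A Littlewood–Paley bump: smooth, spherically symmetric, `ψ = 1` on `B₁(0)`,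
`supp ψ ⊂ B_{3/2}(0)`. -/
structure LPfun {d : ℕ} (ψ : Vd d → ℝ) : Prop where
  smooth : ContDiff ℝ (⊤ : ℕ∞) ψ
  radial : ∀ x y : Vd d, eNorm x = eNorm y → ψ x = ψ y
  supp : ∀ x, 3/2 ≤ eNorm x → ψ x = 0
  one : ∀ x, eNorm x ≤ 1 → ψ x = 1

/-- Littlewood–Paley block `Δ_j f` (with `Δ_{-1}f = f̂(0)`, `Δ_j f = 0` for `j < -1`). -/
def LPblock {d : ℕ} (ψ : Vd d → ℝ) (j : ℤ) (f : Vd d → ℂ) : Vd d → ℂ :=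
  if j < -1 then 0
  else if j = -1 then fun _ => fCoeff f 0
  else fun x => ∑' k : Fin d → ℤ,
    (((ψ (fun i => (k i : ℝ) / 2 ^ j) - ψ (fun i => (k i : ℝ) / 2 ^ (j - 1))) : ℝ) : ℂ)
      * fCoeff f k * Complex.exp (Complex.I * (dotZ k x : ℂ))

/-- Low-frequency projection `S_j f = Σ_{i ≤ j} Δ_i f`. -/
def LPlow {d : ℕ} (ψ : Vd d → ℝ) (j : ℤ) (f : Vd d → ℂ) : Vd d → ℂ :=
  if j < -1 then 0
  else if j = -1 then fun _ => fCoeff f 0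
  else fun x => ∑' k : Fin d → ℤ,
    ((ψ (fun i => (k i : ℝ) / 2 ^ j) : ℝ) : ℂ)
      * fCoeff f k * Complex.exp (Complex.I * (dotZ k x : ℂ))

/-- The high–high paraproduct part
`T_{HH}[f,g] = Σ_j T[Δ_j f, (S_{j+j₀-1} - S_{j-j₀})g]`. -/
def THH (ψ : Vd 2 → ℝ) (j₀ : ℤ) (f g : Vd 2 → ℂ) : Vd 2 → ℂ :=
  fun x => ∑' j : ℤ,
    Tbil (LPblock ψ j f) (fun y => LPlow ψ (j + j₀ - 1) g y - LPlow ψ (j - j₀) g y) x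

section

open scoped SchwartzMap FourierTransform

/-- Every smooth compactly supported symbol on `ℝ²` has a Schwartz convolution kernel. -/
theorem exists_schwartz_kernel (m : Vd 2 → ℝ) (hm : ContDiff ℝ (⊤ : ℕ∞) m)
    (hc : HasCompactSupport m) :
    ∃ K : 𝓢(Vd 2, ℂ), ∀ ξ : Vd 2,
      ∫ z, K z * Complex.exp (-(Complex.I * ((∑ i, ξ i * z i : ℝ) : ℂ))) = (m ξ : ℂ) := by
  let e : EuclideanSpace ℝ (Fin 2) ≃L[ℝ] Vd 2 := EuclideanSpace.equiv (Fin 2) ℝ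
  have h2pi : (2 * Real.pi) ≠ 0 := by positivity
  let M : EuclideanSpace ℝ (Fin 2) → ℂ := fun η => (m ((2 * Real.pi) • e η) : ℂ)
  have hMs : ContDiff ℝ (⊤ : ℕ∞) M :=
    Complex.ofRealCLM.contDiff.comp (hm.comp (e.contDiff.const_smul _))
  have hMc : HasCompactSupport M := by
    have h1 : HasCompactSupport (fun η : EuclideanSpace ℝ (Fin 2) => m ((2 * Real.pi) • e η)) :=
      hc.comp_homeomorph (e.toHomeomorph.trans (Homeomorph.smulOfNeZero (2 * Real.pi) h2pi))
    exact h1.comp_left (g := fun r : ℝ => (r : ℂ)) (by simp)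
  let S : 𝓢(EuclideanSpace ℝ (Fin 2), ℂ) := hMc.toSchwartzMap hMs
  let K0 : 𝓢(EuclideanSpace ℝ (Fin 2), ℂ) := 𝓕⁻ S
  refine ⟨SchwartzMap.compCLMOfContinuousLinearEquiv ℂ e.symm K0, fun ξ => ?_⟩
  have h1 : (𝓕 K0) ((2 * Real.pi)⁻¹ • e.symm ξ) = (m ξ : ℂ) := by
    have : 𝓕 K0 = S := FourierTransform.fourier_fourierInv_eq S
    rw [this]
    change (m ((2 * Real.pi) • e ((2 * Real.pi)⁻¹ • e.symm ξ)) : ℂ) = m ξ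
    rw [map_smul, smul_smul, mul_inv_cancel₀ h2pi, one_smul, e.apply_symm_apply]
  rw [← h1, SchwartzMap.fourier_coe, Real.fourier_eq',
    ← (PiLp.volume_preserving_toLp (Fin 2)).integral_comp
      (MeasurableEquiv.toLp 2 (Fin 2 → ℝ)).measurableEmbedding]
  congr 1
  ext z
  rw [smul_eq_mul, mul_comm]
  congr 1
  congr 1
  rw [real_inner_smul_right]
  have : inner ℝ (WithLp.toLp 2 z) (e.symm ξ) = ∑ i, ξ i * z i := by
    simp [PiLp.inner_apply, e]
  rw [this]
  push_cast
  field_simp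

/-- The `L¹` modulus of continuity of a Schwartz function is Lipschitz. -/
theorem integral_norm_translate_sub_le (K : 𝓢(Vd 2, ℂ)) (b : Vd 2) :
    ∫ z, ‖K (z + b) - K z‖ ≤ (∫ z, ‖fderiv ℝ K z‖) * ‖b‖ := by
  have hcont : Continuous (fderiv ℝ K) := (K.smooth 1).continuous_fderiv one_ne_zero
  have hint : Integrable (fun z => fderiv ℝ K z) :=
    (SchwartzMap.fderivCLM ℝ (Vd 2) ℂ K).integrable
  have hpt : ∀ z, ‖K (z + b) - K z‖ₑ ≤ ∫⁻ t in Set.Icc (0:ℝ) 1, ‖fderiv ℝ K (z + t • b)‖ₑ * ‖b‖ₑ := by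
    intro z
    have hd : ∀ t : ℝ, HasDerivAt (fun t : ℝ => K (z + t • b)) (fderiv ℝ K (z + t • b) b) t := by
      intro t
      have h1 : HasDerivAt (fun t : ℝ => z + t • b) b t := by
        simpa using ((hasDerivAt_id t).smul_const b).const_add z
      exact (K.differentiableAt.hasFDerivAt).comp_hasDerivAt t h1
    have hc2 : Continuous (fun t : ℝ => fderiv ℝ K (z + t • b) b) := by fun_prop
    have := intervalIntegral.integral_eq_sub_of_hasDerivAt (a := 0) (b := 1) (fun t _ => hd t)
      (hc2.intervalIntegrable _ _)
    simp only [one_smul, zero_smul, add_zero] at this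
    rw [← this, intervalIntegral.integral_of_le zero_le_one, ← integral_Icc_eq_integral_Ioc]
    refine (enorm_integral_le_lintegral_enorm _).trans (lintegral_mono fun t => ?_)
    exact ContinuousLinearMap.le_opENorm _ _
  have hL : ∫⁻ z, ‖K (z + b) - K z‖ₑ ≤ (∫⁻ z, ‖fderiv ℝ K z‖ₑ) * ‖b‖ₑ := by
    refine (lintegral_mono hpt).trans ?_
    rw [lintegral_lintegral_swap]
    · have : ∀ t : ℝ, ∫⁻ z, ‖fderiv ℝ K (z + t • b)‖ₑ * ‖b‖ₑ = (∫⁻ z, ‖fderiv ℝ K z‖ₑ) * ‖b‖ₑ := by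
        intro t
        rw [lintegral_mul_const' _ _ enorm_ne_top]
        rw [lintegral_add_right_eq_self (fun z => ‖fderiv ℝ K z‖ₑ)]
      simp [this]
    · apply Continuous.aemeasurable
      have : Continuous (fun p : Vd 2 × ℝ => fderiv ℝ K (p.1 + p.2 • b)) := by fun_prop
      unfold Function.uncurry
      exact (ENNReal.continuous_mul_const enorm_ne_top).comp this.enorm
  have hint2 : Integrable (fun z => K (z + b) - K z) :=
    (K.integrable.comp_add_right b).sub K.integrable
  rw [integral_norm_eq_lintegral_enorm hint2.aestronglyMeasurable,
    integral_norm_eq_lintegral_enorm hint.aestronglyMeasurable, ← toReal_enorm b,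
    ← ENNReal.toReal_mul]
  exact ENNReal.toReal_mono (ENNReal.mul_ne_top hint.2.ne enorm_ne_top) hL

/-- The character `x ↦ e^{ik·x}`. -/
def expZ {d : ℕ} (k : Fin d → ℤ) : Vd d → ℂ := fun x => Complex.exp (Complex.I * (dotZ k x : ℂ))

/-- `K` is a convolution kernel of the Fourier multiplier with symbol `m`. -/
def HasSymbol (K : 𝓢(Vd 2, ℂ)) (m : Vd 2 → ℝ) : Prop :=
  ∀ ξ : Vd 2, ∫ z, K z * Complex.exp (-(Complex.I * ((∑ i, ξ i * z i : ℝ) : ℂ))) = (m ξ : ℂ)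

/-- Convolution with the kernel `K` rescaled to length `ε`. -/
def scaledConv (K : 𝓢(Vd 2, ℂ)) (ε : ℝ) (F : Vd 2 → ℂ) : Vd 2 → ℂ :=
  fun x => ∫ z, K z * F (x - ε • z)

section Characters

variable {d : ℕ}

theorem continuous_dotZ (k : Fin d → ℤ) : Continuous (dotZ k) := by
  unfold dotZ; fun_prop

theorem continuous_expZ (k : Fin d → ℤ) : Continuous (expZ k) := by
  have := continuous_dotZ k
  unfold expZ; fun_prop

theorem norm_expZ (k : Fin d → ℤ) (x : Vd d) : ‖expZ k x‖ = 1 := by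
  rw [expZ, mul_comm]; exact Complex.norm_exp_ofReal_mul_I _

theorem dotZ_add (k : Fin d → ℤ) (x y : Vd d) : dotZ k (x + y) = dotZ k x + dotZ k y := by
  simp [dotZ, mul_add, Finset.sum_add_distrib]

theorem dotZ_smul (k : Fin d → ℤ) (c : ℝ) (x : Vd d) : dotZ k (c • x) = c * dotZ k x := by
  simp only [dotZ, Pi.smul_apply, smul_eq_mul, Finset.mul_sum]
  exact Finset.sum_congr rfl fun i _ => by ring

theorem dotZ_add_left (k l : Fin d → ℤ) (x : Vd d) : dotZ (k + l) x = dotZ k x + dotZ l x := by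
  simp [dotZ, add_mul, Finset.sum_add_distrib]

theorem expZ_add (k : Fin d → ℤ) (x y : Vd d) : expZ k (x + y) = expZ k x * expZ k y := by
  simp [expZ, dotZ_add, mul_add, Complex.exp_add]

theorem expZ_add_left (k l : Fin d → ℤ) : expZ (k + l) = expZ k * expZ l := by
  ext x; simp [expZ, dotZ_add_left, mul_add, Complex.exp_add]

theorem expZ_zero (x : Vd d) : expZ 0 x = 1 := by simp [expZ, dotZ]

theorem expZ_latt (k m : Fin d → ℤ) : expZ k (latt m) = 1 := by
  rw [expZ, Complex.exp_eq_one_iff]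
  refine ⟨∑ i, k i * m i, ?_⟩
  simp only [dotZ, latt]
  push_cast
  rw [Finset.mul_sum, Finset.sum_mul]
  exact Finset.sum_congr rfl fun i _ => by ring

theorem torusFun_expZ (k : Fin d → ℤ) : TorusFun (expZ k) := fun x m => by
  rw [expZ_add, expZ_latt, mul_one]

end Characters

section ScaledConv

variable {K : 𝓢(Vd 2, ℂ)} {ε : ℝ} {F G : Vd 2 → ℂ}

theorem integrable_kernel_mul (K : 𝓢(Vd 2, ℂ)) {B : ℝ} {H : Vd 2 → ℂ} (hH : Continuous H)
    (hB : ∀ x, ‖H x‖ ≤ B) : Integrable fun z => K z * H z :=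
  K.integrable.mul_bdd hH.aestronglyMeasurable (Filter.Eventually.of_forall hB)

theorem norm_integral_kernel_mul_le (K : 𝓢(Vd 2, ℂ)) {B : ℝ} {H : Vd 2 → ℂ}
    (hB : ∀ x, ‖H x‖ ≤ B) : ‖∫ z, K z * H z‖ ≤ (∫ z, ‖K z‖) * B := by
  rw [← integral_mul_const]
  refine norm_integral_le_of_norm_le (K.integrable.norm.mul_const B)
    (Filter.Eventually.of_forall fun z => ?_)
  rw [norm_mul]
  exact mul_le_mul_of_nonneg_left (hB z) (norm_nonneg _)

theorem norm_scaledConv_le (K : 𝓢(Vd 2, ℂ)) (ε : ℝ) {B : ℝ} (hB : ∀ x, ‖F x‖ ≤ B) (x : Vd 2) :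
    ‖scaledConv K ε F x‖ ≤ (∫ z, ‖K z‖) * B :=
  norm_integral_kernel_mul_le K fun _ => hB _

theorem scaledConv_sub (hF : Continuous F) (hG : Continuous G) {B B' : ℝ} (hB : ∀ x, ‖F x‖ ≤ B)
    (hB' : ∀ x, ‖G x‖ ≤ B') (x : Vd 2) :
    scaledConv K ε (fun y => F y - G y) x = scaledConv K ε F x - scaledConv K ε G x := by
  unfold scaledConv
  rw [← integral_sub (integrable_kernel_mul K (by fun_prop) fun _ => hB _)
    (integrable_kernel_mul K (by fun_prop) fun _ => hB' _)]
  simp only [mul_sub]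

theorem norm_scaledConv_add_sub_le (K : 𝓢(Vd 2, ℂ)) (hε : 0 < ε) (hF : Continuous F) {B : ℝ}
    (hB : ∀ x, ‖F x‖ ≤ B) (x a : Vd 2) :
    ‖scaledConv K ε F (x + a) - scaledConv K ε F x‖
      ≤ (∫ z, ‖fderiv ℝ K z‖) * (‖a‖ / ε) * B := by
  have h1 : scaledConv K ε F (x + a) = ∫ z, K (z + ε⁻¹ • a) * F (x - ε • z) := by
    unfold scaledConv
    rw [← integral_add_right_eq_self _ (ε⁻¹ • a)]
    congr 1; ext z
    congr 2
    rw [smul_add, smul_smul, mul_inv_cancel₀ hε.ne', one_smul]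
    abel
  have hB0 : 0 ≤ B := (norm_nonneg _).trans (hB 0)
  have hFc : Continuous fun z : Vd 2 => F (x - ε • z) := by fun_prop
  have hI1 : Integrable fun z => K (z + ε⁻¹ • a) * F (x - ε • z) :=
    (K.integrable.comp_add_right (ε⁻¹ • a)).mul_bdd (c := B) hFc.aestronglyMeasurable
      (Filter.Eventually.of_forall fun _ => hB _)
  have hI2 : Integrable fun z => K (z + ε⁻¹ • a) - K z :=
    (K.integrable.comp_add_right (ε⁻¹ • a)).sub K.integrable
  rw [h1, scaledConv, ← integral_sub hI1 (integrable_kernel_mul K hFc fun _ => hB _)]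
  calc _ ≤ ∫ z, ‖K (z + ε⁻¹ • a) - K z‖ * B := by
        refine norm_integral_le_of_norm_le (hI2.norm.mul_const B)
          (Filter.Eventually.of_forall fun z => ?_)
        rw [← sub_mul, norm_mul]
        exact mul_le_mul_of_nonneg_left (hB _) (norm_nonneg _)
    _ ≤ _ := by
        rw [integral_mul_const]
        refine mul_le_mul_of_nonneg_right ((integral_norm_translate_sub_le K _).trans_eq ?_) hB0
        rw [norm_smul, norm_inv, Real.norm_of_nonneg hε.le]
        ring

theorem scaledConv_expZ {m : Vd 2 → ℝ} (hK : HasSymbol K m) (k : Fin 2 → ℤ) (x : Vd 2) :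
    scaledConv K ε (expZ k) x = (m (fun i => ε * k i) : ℂ) * expZ k x := by
  rw [← hK, ← integral_mul_const]
  unfold scaledConv
  congr 1; ext z
  rw [sub_eq_add_neg, expZ_add, ← mul_assoc, mul_right_comm, expZ, expZ]
  congr 3
  rw [← neg_smul, dotZ_smul, dotZ]
  push_cast
  simp only [Finset.mul_sum, ← Finset.sum_neg_distrib]
  exact Finset.sum_congr rfl fun i _ => by ring

theorem scaledConv_sum {m : Vd 2 → ℝ} (hK : HasSymbol K m) (s : Finset (Fin 2 → ℤ))
    (c : (Fin 2 → ℤ) → ℂ) (x : Vd 2) :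
    scaledConv K ε (fun y => ∑ k ∈ s, c k * expZ k y) x
      = ∑ k ∈ s, (m (fun i => ε * k i) : ℂ) * c k * expZ k x := by
  have : ∀ k, (m (fun i => ε * k i) : ℂ) * c k * expZ k x = c k * scaledConv K ε (expZ k) x := by
    intro k; rw [scaledConv_expZ hK]; ring
  simp only [this]
  unfold scaledConv
  simp only [Finset.mul_sum, ← integral_const_mul]
  rw [integral_finsetSum]
  · exact Finset.sum_congr rfl fun k _ => by congr 1; ext z; ring
  · intro k _
    have h := (continuous_expZ k)
    exact integrable_kernel_mul K (B := ‖c k‖) (by fun_prop) fun z => by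
      rw [norm_mul, norm_expZ, mul_one]

end ScaledConv

section FourierCoefficients

variable {d : ℕ}

theorem volume_real_box : (volume : Measure (Vd d)).real (box d) = (2 * Real.pi) ^ d := by
  rw [Measure.real, box, Real.volume_Icc_pi]
  simp [ENNReal.toReal_ofReal Real.pi_pos.le]

theorem isCompact_box : IsCompact (box d) := isCompact_Icc

theorem integrableOn_mul_char {F : Vd d → ℂ} (hF : Continuous F) (k : Fin d → ℤ) :
    IntegrableOn (fun x => F x * Complex.exp (-(Complex.I * (dotZ k x : ℂ)))) (box d) := by
  have := continuous_dotZ k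
  exact Continuous.integrableOn_Icc (by fun_prop)

theorem integral_char (n : ℤ) :
    ∫ t in Set.Icc (0:ℝ) (2 * Real.pi), Complex.exp (Complex.I * n * t)
      = if n = 0 then (2 * Real.pi : ℂ) else 0 := by
  rw [integral_Icc_eq_integral_Ioc, ← intervalIntegral.integral_of_le (by positivity)]
  split_ifs with h
  · simp [h]
  · rw [integral_exp_mul_complex (by simp [h])]
    have : Complex.exp (Complex.I * n * ((2 * Real.pi : ℝ) : ℂ)) = 1 := by
      rw [Complex.exp_eq_one_iff]
      exact ⟨n, by push_cast; ring⟩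
    rw [this]
    simp

theorem fCoeff_expZ (k l : Fin d → ℤ) : fCoeff (expZ k) l = if k = l then 1 else 0 := by
  have h1 : ∀ x : Vd d, expZ k x * Complex.exp (-(Complex.I * (dotZ l x : ℂ)))
      = ∏ i, Complex.exp (Complex.I * ((k i - l i : ℤ) : ℂ) * (x i : ℂ)) := by
    intro x
    rw [expZ, ← Complex.exp_add, ← Complex.exp_sum]
    congr 1
    simp only [dotZ]
    push_cast
    rw [← mul_neg, ← mul_add, ← sub_eq_add_neg, ← Finset.sum_sub_distrib, Finset.mul_sum]
    exact Finset.sum_congr rfl fun i _ => by ring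
  have h2 : box d = Set.univ.pi fun _ => Set.Icc (0:ℝ) (2 * Real.pi) := by
    rw [Set.pi_univ_Icc]; rfl
  rw [fCoeff]
  simp only [h1]
  rw [h2, volume_pi, Measure.restrict_pi_pi, integral_fintype_prod_eq_prod
    (fun i (t : ℝ) => Complex.exp (Complex.I * ((k i - l i : ℤ) : ℂ) * (t : ℂ)))]
  simp only [integral_char]
  split_ifs with h
  · subst h
    simp only [sub_self, if_true, Finset.prod_const, Finset.card_univ, Fintype.card_fin,
      Complex.real_smul]
    push_cast
    refine inv_mul_cancel₀ (pow_ne_zero _ ?_)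
    simp [Real.pi_ne_zero]
  · obtain ⟨i, hi⟩ := Function.ne_iff.mp h
    rw [Finset.prod_eq_zero (Finset.mem_univ i) (if_neg (sub_ne_zero.mpr hi)), smul_zero]

theorem fCoeff_sum (s : Finset (Fin d → ℤ)) (c : (Fin d → ℤ) → ℂ) (l : Fin d → ℤ) :
    fCoeff (fun x => ∑ k ∈ s, c k * expZ k x) l = if l ∈ s then c l else 0 := by
  have h1 : fCoeff (fun x => ∑ k ∈ s, c k * expZ k x) l = ∑ k ∈ s, c k * fCoeff (expZ k) l := by
    unfold fCoeff
    simp only [Finset.sum_mul, mul_assoc]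
    rw [integral_finsetSum]
    · rw [Finset.smul_sum]
      refine Finset.sum_congr rfl fun k _ => ?_
      rw [integral_const_mul, mul_smul_comm]
    · intro k _
      exact (integrableOn_mul_char (continuous_expZ k) l).const_mul (c k)
  rw [h1]
  simp [fCoeff_expZ]

theorem fCoeff_sub {F G : Vd d → ℂ} (hF : Continuous F) (hG : Continuous G) (k : Fin d → ℤ) :
    fCoeff (fun x => F x - G x) k = fCoeff F k - fCoeff G k := by
  unfold fCoeff
  rw [← smul_sub, ← integral_sub (integrableOn_mul_char hF k) (integrableOn_mul_char hG k)]
  simp only [sub_mul]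

theorem norm_fCoeff_le {F : Vd d → ℂ} {B : ℝ} (hB : ∀ x, ‖F x‖ ≤ B) (k : Fin d → ℤ) :
    ‖fCoeff F k‖ ≤ B := by
  have h0 : (0:ℝ) < (2 * Real.pi) ^ d := by positivity
  rw [fCoeff, norm_smul, norm_inv, Real.norm_of_nonneg h0.le, inv_mul_le_iff₀ h0, mul_comm,
    ← volume_real_box]
  refine norm_setIntegral_le_of_norm_le_const isCompact_box.measure_lt_top fun x _ => ?_
  rw [norm_mul, mul_comm Complex.I, ← neg_mul, ← Complex.ofReal_neg, Complex.norm_exp_ofReal_mul_I,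
    mul_one]
  exact hB x

theorem fCoeff_zero (k : Fin d → ℤ) : fCoeff (0 : Vd d → ℂ) k = 0 := by
  simp [fCoeff]

end FourierCoefficients

section TrigonometricPolynomials

theorem eNorm_nonneg {d : ℕ} (x : Vd d) : 0 ≤ eNorm x := Real.sqrt_nonneg _

theorem eNorm_eq_norm {d : ℕ} (x : Vd d) : eNorm x = ‖(WithLp.toLp 2 x : EuclideanSpace ℝ (Fin d))‖ := by
  simp [eNorm, EuclideanSpace.norm_eq]

theorem eNorm_smul {d : ℕ} (c : ℝ) (x : Vd d) : eNorm (fun i => c * x i) = |c| * eNorm x := by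
  rw [eNorm_eq_norm, eNorm_eq_norm, ← Real.norm_eq_abs, ← norm_smul]
  rfl

theorem norm_le_eNorm {d : ℕ} (x : Vd d) : ‖x‖ ≤ eNorm x := by
  refine (pi_norm_le_iff_of_nonneg (eNorm_nonneg x)).mpr fun i => ?_
  rw [eNorm_eq_norm]
  exact PiLp.norm_apply_le (WithLp.toLp 2 x : EuclideanSpace ℝ (Fin d)) i

theorem kAbs_add_le {d : ℕ} (k l : Fin d → ℤ) : kAbs (k + l) ≤ kAbs k + kAbs l := by
  simp only [kAbs, eNorm_eq_norm]
  refine le_of_eq_of_le ?_ (norm_add_le _ _)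
  congr 1
  ext i
  simp

theorem one_le_kAbs {d : ℕ} {k : Fin d → ℤ} (hk : k ≠ 0) : 1 ≤ kAbs k := by
  obtain ⟨i, hi⟩ := Function.ne_iff.mp hk
  refine le_trans ?_ ((norm_le_pi_norm (fun i => (k i : ℝ)) i).trans (norm_le_eNorm _))
  rw [Real.norm_eq_abs]
  exact_mod_cast Int.one_le_abs hi

theorem kAbs_zero {d : ℕ} : kAbs (0 : Fin d → ℤ) = 0 := by
  simp [kAbs, eNorm]

theorem finite_kAbs_le {d : ℕ} (R : ℝ) : {k : Fin d → ℤ | kAbs k ≤ R}.Finite := by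
  refine (Set.finite_Icc (fun _ : Fin d => -⌈R⌉) (fun _ => ⌈R⌉)).subset fun k hk => ?_
  have : ∀ i, |k i| ≤ ⌈R⌉ := fun i => by
    have h1 : |(k i : ℝ)| ≤ R :=
      ((norm_le_pi_norm (fun i => (k i : ℝ)) i).trans (norm_le_eNorm _)).trans hk
    exact_mod_cast h1.trans (Int.le_ceil R)
  exact ⟨fun i => (abs_le.mp (this i)).1, fun i => (abs_le.mp (this i)).2⟩

/-- The frequencies of modulus at most `R`. -/
def freqBall (d : ℕ) (R : ℝ) : Finset (Fin d → ℤ) := (finite_kAbs_le R).toFinset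

theorem mem_freqBall {d : ℕ} {R : ℝ} {k : Fin d → ℤ} : k ∈ freqBall d R ↔ kAbs k ≤ R := by
  simp [freqBall]

/-- Trigonometric polynomials with frequencies of modulus at most `R`. -/
def trigPoly (d : ℕ) (R : ℝ) : Submodule ℂ (Vd d → ℂ) :=
  Submodule.span ℂ (expZ '' {k | kAbs k ≤ R})

variable {d : ℕ} {R R' : ℝ} {p q : Vd d → ℂ}

theorem mem_trigPoly_iff :
    p ∈ trigPoly d R ↔ ∃ c : (Fin d → ℤ) → ℂ, p = fun x => ∑ k ∈ freqBall d R, c k * expZ k x := by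
  have : {k : Fin d → ℤ | kAbs k ≤ R} = ↑(freqBall d R) := by ext; simp [mem_freqBall]
  rw [trigPoly, this, Submodule.mem_span_image_finset_iff_exists_fun']
  refine exists_congr fun c => ?_
  rw [eq_comm]
  refine Eq.congr_right ?_
  ext x
  simp

theorem sum_mem_trigPoly {s : Finset (Fin d → ℤ)} (hs : ∀ k ∈ s, kAbs k ≤ R)
    (c : (Fin d → ℤ) → ℂ) : (fun x => ∑ k ∈ s, c k * expZ k x) ∈ trigPoly d R := by
  have : (fun x => ∑ k ∈ s, c k * expZ k x) = ∑ k ∈ s, c k • expZ k := by ext x; simp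
  rw [this]
  exact Submodule.sum_mem _ fun k hk =>
    Submodule.smul_mem _ _ (Submodule.subset_span ⟨k, hs k hk, rfl⟩)

theorem trigPoly_mono (h : R ≤ R') : trigPoly d R ≤ trigPoly d R' :=
  Submodule.span_mono (Set.image_mono fun _ hk => le_trans hk h)

theorem mul_mem_trigPoly (hp : p ∈ trigPoly d R) (hq : q ∈ trigPoly d R') :
    p * q ∈ trigPoly d (R + R') := by
  have h := Submodule.mul_mem_mul hp hq
  rw [trigPoly, trigPoly, Submodule.span_mul_span] at h
  refine Submodule.span_mono ?_ h
  rintro _ ⟨_, ⟨k, hk, rfl⟩, _, ⟨l, hl, rfl⟩, rfl⟩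
  exact ⟨k + l, (kAbs_add_le k l).trans (add_le_add hk hl), expZ_add_left k l⟩

theorem continuous_of_mem_trigPoly (hp : p ∈ trigPoly d R) : Continuous p := by
  obtain ⟨c, rfl⟩ := mem_trigPoly_iff.mp hp
  have := fun k : Fin d → ℤ => continuous_expZ k
  fun_prop

theorem torusFun_of_mem_trigPoly (hp : p ∈ trigPoly d R) : TorusFun p := by
  obtain ⟨c, rfl⟩ := mem_trigPoly_iff.mp hp
  intro x m
  simp only [torusFun_expZ _ x m]

theorem fmul_sum (m : (Fin d → ℤ) → ℂ) (s : Finset (Fin d → ℤ)) (c : (Fin d → ℤ) → ℂ) :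
    fmul m (fun x => ∑ k ∈ s, c k * expZ k x) = fun x => ∑ k ∈ s, m k * c k * expZ k x := by
  ext x
  simp only [fmul, fCoeff_sum]
  rw [tsum_eq_sum (s := s)]
  · exact Finset.sum_congr rfl fun k hk => by rw [if_pos hk]; rfl
  · intro k hk
    simp [hk]

theorem fmul_mem_trigPoly (m : (Fin d → ℤ) → ℂ) (hp : p ∈ trigPoly d R) :
    fmul m p ∈ trigPoly d R := by
  obtain ⟨c, rfl⟩ := mem_trigPoly_iff.mp hp
  rw [fmul_sum]
  exact sum_mem_trigPoly (fun k hk => mem_freqBall.mp hk) _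

end TrigonometricPolynomials

section Density

variable {d : ℕ}

/-- The covering map `ℝ^d → (ℝ/ℤ)^d`, `x ↦ x / 2π`. -/
def toUnitTorus (x : Vd d) : UnitAddTorus (Fin d) := fun i => ((x i / (2 * Real.pi) : ℝ) : UnitAddCircle)

theorem mFourier_toUnitTorus (k : Fin d → ℤ) (x : Vd d) :
    UnitAddTorus.mFourier k (toUnitTorus x) = expZ k x := by
  simp only [UnitAddTorus.mFourier, ContinuousMap.coe_mk, toUnitTorus, fourier_coe_apply]
  rw [← Complex.exp_sum, expZ]
  congr 1
  simp only [dotZ]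
  push_cast
  rw [Finset.mul_sum]
  refine Finset.sum_congr rfl fun i _ => ?_
  have : (Real.pi : ℂ) ≠ 0 := by simp [Real.pi_ne_zero]
  field_simp

theorem isOpenQuotientMap_toUnitTorus : IsOpenQuotientMap (toUnitTorus (d := d)) := by
  have h1 : IsOpenQuotientMap (Pi.map fun (_ : Fin d) (t : ℝ) => (t : UnitAddCircle)) :=
    IsOpenQuotientMap.piMap fun _ => QuotientAddGroup.isOpenQuotientMap_mk
  have h2 : (2 * Real.pi)⁻¹ ≠ 0 := by positivity
  have h3 := h1.comp (Homeomorph.smulOfNeZero (α := Vd d) (2 * Real.pi)⁻¹ h2).isOpenQuotientMap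
  convert h3 using 1
  ext x i
  simp [toUnitTorus, Pi.map, div_eq_inv_mul]

theorem eq_of_toUnitTorus_eq {F : Vd d → ℂ} (hF : TorusFun F) {x y : Vd d}
    (h : toUnitTorus x = toUnitTorus y) : F x = F y := by
  have : ∀ i, ∃ n : ℤ, x i - y i = 2 * Real.pi * n := by
    intro i
    have hi := congrFun h i
    rw [toUnitTorus, toUnitTorus, QuotientAddGroup.eq_iff_sub_mem,
      AddSubgroup.mem_zmultiples_iff] at hi
    obtain ⟨n, hn⟩ := hi
    refine ⟨n, ?_⟩
    have := Real.pi_ne_zero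
    simp only [zsmul_eq_mul, mul_one] at hn
    rw [hn]
    field_simp
  choose m hm using this
  rw [← hF y m]
  congr 1
  ext i
  simp [latt, ← hm]

/-- Trigonometric polynomials are uniformly dense in the continuous periodic functions. -/
theorem exists_trigPoly_near {F : Vd d → ℂ} (hc : Continuous F) (hF : TorusFun F) {δ : ℝ}
    (hδ : 0 < δ) : ∃ R, ∃ p ∈ trigPoly d R, ∀ x, ‖F x - p x‖ ≤ δ := by
  have hπ := isOpenQuotientMap_toUnitTorus (d := d)
  let F' : UnitAddTorus (Fin d) → ℂ := fun t => F (Function.surjInv hπ.surjective t)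
  have hF' : ∀ x, F' (toUnitTorus x) = F x := fun x =>
    eq_of_toUnitTorus_eq hF (Function.surjInv_eq hπ.surjective _)
  have hc' : Continuous F' := by
    rw [hπ.isQuotientMap.continuous_iff]
    exact hc.congr fun x => (hF' x).symm
  have hmem : (⟨F', hc'⟩ : C(UnitAddTorus (Fin d), ℂ)) ∈
      (Submodule.span ℂ (Set.range <| UnitAddTorus.mFourier (d := Fin d))).topologicalClosure := by
    rw [UnitAddTorus.span_mFourier_closure_eq_top]
    trivial
  obtain ⟨P, hP, hdist⟩ := Metric.mem_closure_iff.mp hmem δ hδ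
  obtain ⟨c, rfl⟩ := Finsupp.mem_span_range_iff_exists_finsupp.mp hP
  obtain ⟨R, hR⟩ : ∃ R, ∀ k ∈ c.support, kAbs k ≤ R :=
    ⟨∑ k ∈ c.support, kAbs k, fun k hk =>
      Finset.single_le_sum (f := kAbs) (fun _ _ => eNorm_nonneg _) hk⟩
  refine ⟨R, _, sum_mem_trigPoly hR c, fun x => ?_⟩
  have h := (ContinuousMap.dist_apply_le_dist (toUnitTorus x)).trans hdist.le
  rw [dist_eq_norm] at h
  refine le_of_eq_of_le ?_ h
  congr 1
  rw [ContinuousMap.coe_mk, hF', Finsupp.sum, ContinuousMap.sum_apply]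
  simp [mFourier_toUnitTorus]

theorem exists_norm_le {E : Type*} [NormedAddCommGroup E] {F : Vd d → E} (hc : Continuous F)
    (hF : TorusFun F) : ∃ B, ∀ x, ‖F x‖ ≤ B := by
  obtain ⟨B, hB⟩ := (isCompact_box (d := d)).exists_bound_of_continuousOn hc.continuousOn
  refine ⟨B, fun x => ?_⟩
  have hpi := Real.two_pi_pos
  rw [← hF x fun i => -⌊x i / (2 * Real.pi)⌋]
  refine hB _ ⟨fun i => ?_, fun i => ?_⟩
  · have := Int.floor_le (x i / (2 * Real.pi))
    rw [le_div_iff₀ hpi] at this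
    simp [latt]
    linarith
  · have := (Int.lt_floor_add_one (x i / (2 * Real.pi))).le
    rw [div_le_iff₀ hpi] at this
    simp [latt]
    linarith

/-- A finite multiplier agrees with convolution against its kernel on continuous
periodic functions. -/
theorem sum_fCoeff_eq_scaledConv {K : 𝓢(Vd 2, ℂ)} {m : Vd 2 → ℝ} (hK : HasSymbol K m) {ε : ℝ}
    {s : Finset (Fin 2 → ℤ)} (hs : ∀ k, m (fun i => ε * k i) ≠ 0 → k ∈ s) {F : Vd 2 → ℂ}
    (hc : Continuous F) (hF : TorusFun F) (x : Vd 2) :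
    ∑ k ∈ s, (m (fun i => ε * k i) : ℂ) * fCoeff F k * expZ k x = scaledConv K ε F x := by
  set A : ℝ := ∑ k ∈ s, |m (fun i => ε * k i)| with hA
  set B : ℝ := ∫ z, ‖K z‖ with hB
  have hA0 : 0 ≤ A := Finset.sum_nonneg fun _ _ => abs_nonneg _
  have hB0 : 0 ≤ B := integral_nonneg fun _ => norm_nonneg _
  have key : ∀ δ > 0, ‖∑ k ∈ s, (m (fun i => ε * k i) : ℂ) * fCoeff F k * expZ k x
      - scaledConv K ε F x‖ ≤ (A + B) * δ := by
    intro δ hδ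
    obtain ⟨R, p, hp, hFp⟩ := exists_trigPoly_near hc hF hδ
    have hpc := continuous_of_mem_trigPoly hp
    have e1 : ∑ k ∈ s, (m (fun i => ε * k i) : ℂ) * fCoeff p k * expZ k x
        = scaledConv K ε p x := by
      obtain ⟨c, rfl⟩ := mem_trigPoly_iff.mp hp
      rw [scaledConv_sum hK]
      simp only [fCoeff_sum]
      rw [Finset.sum_subset Finset.subset_union_left
        (f := fun k => (m (fun i => ε * k i) : ℂ) * (if k ∈ freqBall 2 R then c k else 0) * expZ k x)
        (s₂ := s ∪ freqBall 2 R)]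
      · rw [← Finset.sum_subset (Finset.subset_union_right (s₁ := s))]
        · exact Finset.sum_congr rfl fun k hk => by rw [if_pos hk]
        · intro k _ hk; simp [hk]
      · intro k _ hk
        have : m (fun i => ε * k i) = 0 := by
          by_contra h
          exact hk (hs k h)
        simp [this]
    obtain ⟨BF, hBF⟩ := exists_norm_le hc hF
    obtain ⟨Bp, hBp⟩ := exists_norm_le hpc (torusFun_of_mem_trigPoly hp)
    have e2 : ∑ k ∈ s, (m (fun i => ε * k i) : ℂ) * fCoeff F k * expZ k x - scaledConv K ε F x
        = ∑ k ∈ s, (m (fun i => ε * k i) : ℂ) * fCoeff (fun y => F y - p y) k * expZ k x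
          - scaledConv K ε (fun y => F y - p y) x := by
      rw [scaledConv_sub hc hpc hBF hBp, ← e1]
      simp only [fCoeff_sub hc hpc, mul_sub, sub_mul, Finset.sum_sub_distrib]
      ring
    rw [e2, add_mul]
    refine (norm_sub_le _ _).trans (add_le_add ?_ (norm_scaledConv_le K ε hFp x))
    rw [hA, Finset.sum_mul]
    refine norm_sum_le_of_le _ fun k _ => ?_
    rw [norm_mul, norm_mul, norm_expZ, mul_one, Complex.norm_real, Real.norm_eq_abs]
    exact mul_le_mul_of_nonneg_left (norm_fCoeff_le hFp k) (abs_nonneg _)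
  rw [← sub_eq_zero, ← norm_le_zero_iff]
  refine le_of_forall_pos_le_add fun η hη => ?_
  refine (key (η / (A + B + 1)) (by positivity)).trans ?_
  rw [zero_add, mul_div_assoc', div_le_iff₀ (by positivity)]
  nlinarith

end Density

section Symbols

variable {ψ : Vd 2 → ℝ}

/-- The annular Littlewood–Paley symbol `ψ(ξ) - ψ(2ξ)`. -/
def annulus (ψ : Vd 2 → ℝ) (ξ : Vd 2) : ℝ := ψ ξ - ψ (fun i => 2 * ξ i)

theorem LPfun.eq_zero_smul (hψ : LPfun ψ) {c : ℝ} {ξ : Vd 2} (h : 3 / 2 ≤ |c| * eNorm ξ) :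
    ψ (fun i => c * ξ i) = 0 := hψ.supp _ (by rwa [eNorm_smul])

theorem LPfun.eq_one_smul (hψ : LPfun ψ) {c : ℝ} {ξ : Vd 2} (h : |c| * eNorm ξ ≤ 1) :
    ψ (fun i => c * ξ i) = 1 := hψ.one _ (by rwa [eNorm_smul])

theorem LPfun.smooth_smul (hψ : LPfun ψ) (c : ℝ) :
    ContDiff ℝ (⊤ : ℕ∞) fun ξ : Vd 2 => ψ (fun i => c * ξ i) :=
  hψ.smooth.comp (contDiff_const_smul c)

theorem hasCompactSupport_of_eNorm {h : Vd 2 → ℝ} (R : ℝ) (hR : ∀ ξ, R ≤ eNorm ξ → h ξ = 0) :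
    HasCompactSupport h := by
  refine HasCompactSupport.intro (isCompact_closedBall (0 : Vd 2) R) fun ξ hξ => hR ξ ?_
  rw [mem_closedBall_zero_iff, not_le] at hξ
  exact hξ.le.trans (norm_le_eNorm ξ)

theorem annulus_eq_zero_of_le (hψ : LPfun ψ) {ξ : Vd 2} (h : eNorm ξ ≤ 1 / 2) :
    annulus ψ ξ = 0 := by
  rw [annulus, hψ.one _ (by linarith), hψ.eq_one_smul (by rw [abs_two]; linarith), sub_self]

theorem annulus_eq_zero_of_ge (hψ : LPfun ψ) {ξ : Vd 2} (h : 3 / 2 ≤ eNorm ξ) :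
    annulus ψ ξ = 0 := by
  rw [annulus, hψ.supp _ h, hψ.eq_zero_smul (by rw [abs_two]; linarith), sub_self]

theorem smooth_annulus (hψ : LPfun ψ) : ContDiff ℝ (⊤ : ℕ∞) (annulus ψ) :=
  hψ.smooth.sub (hψ.smooth_smul 2)

theorem contDiffAt_eNorm {ξ : Vd 2} (h : ξ ≠ 0) : ContDiffAt ℝ (⊤ : ℕ∞) (eNorm (d := 2)) ξ := by
  refine ContDiffAt.sqrt (by fun_prop) fun h0 => h ?_
  rw [Finset.sum_eq_zero_iff_of_nonneg fun i _ => sq_nonneg _] at h0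
  ext i
  simpa using h0 i

theorem eNorm_pos {ξ : Vd 2} (h : ξ ≠ 0) : 0 < eNorm ξ :=
  (norm_pos_iff.mpr h).trans_le (norm_le_eNorm ξ)

theorem contDiff_of_eq_zero_near {q : Vd 2 → ℝ} {r : ℝ} (hr : 0 < r)
    (h0 : ∀ ξ, eNorm ξ ≤ r → q ξ = 0) (hq : ∀ ξ, ξ ≠ 0 → ContDiffAt ℝ (⊤ : ℕ∞) q ξ) :
    ContDiff ℝ (⊤ : ℕ∞) q := by
  rw [contDiff_iff_contDiffAt]
  intro ξ
  by_cases h : ξ = 0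
  · have hc : Continuous (eNorm (d := 2)) := by unfold eNorm; fun_prop
    have hlt : eNorm ξ < r := by simpa [h, eNorm] using hr
    refine (contDiffAt_const (c := (0:ℝ))).congr_of_eventuallyEq ?_
    filter_upwards [hc.continuousAt.eventually_lt continuousAt_const hlt] with y hy
    exact h0 y hy.le
  · exact hq ξ h

theorem contDiff_eNorm_mul {h : Vd 2 → ℝ} (hh : ContDiff ℝ (⊤ : ℕ∞) h) {r : ℝ} (hr : 0 < r)
    (h0 : ∀ ξ, eNorm ξ ≤ r → h ξ = 0) : ContDiff ℝ (⊤ : ℕ∞) fun ξ => eNorm ξ * h ξ :=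
  contDiff_of_eq_zero_near hr (fun ξ hξ => by rw [h0 ξ hξ, mul_zero])
    fun _ hξ => (contDiffAt_eNorm hξ).mul hh.contDiffAt

theorem contDiff_div_eNorm {h : Vd 2 → ℝ} (hh : ContDiff ℝ (⊤ : ℕ∞) h) {r : ℝ} (hr : 0 < r)
    (h0 : ∀ ξ, eNorm ξ ≤ r → h ξ = 0) : ContDiff ℝ (⊤ : ℕ∞) fun ξ => h ξ / eNorm ξ :=
  contDiff_of_eq_zero_near hr (fun ξ hξ => by rw [h0 ξ hξ, zero_div])
    fun _ hξ => hh.contDiffAt.div (contDiffAt_eNorm hξ) (eNorm_pos hξ).ne'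

theorem exists_kernel_annulus (hψ : LPfun ψ) : ∃ K, HasSymbol K (annulus ψ) :=
  exists_schwartz_kernel _ (smooth_annulus hψ)
    (hasCompactSupport_of_eNorm (3 / 2) fun _ h => annulus_eq_zero_of_ge hψ h)

theorem exists_kernel_annulus_div (hψ : LPfun ψ) :
    ∃ K, HasSymbol K fun ξ => annulus ψ ξ / eNorm ξ :=
  exists_schwartz_kernel _
    (contDiff_div_eNorm (smooth_annulus hψ) one_half_pos fun _ h => annulus_eq_zero_of_le hψ h)
    (hasCompactSupport_of_eNorm (3 / 2) fun _ h => by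
      rw [annulus_eq_zero_of_ge hψ h, zero_div])

theorem exists_kernel_low (hψ : LPfun ψ) : ∃ K, HasSymbol K fun ξ => ψ (fun i => 1 / 4 * ξ i) :=
  exists_schwartz_kernel _ (hψ.smooth_smul (1 / 4))
    (hasCompactSupport_of_eNorm 6 fun ξ h => hψ.eq_zero_smul (by
      rw [abs_of_pos (by norm_num)]; linarith))

/-- There is a kernel whose symbol is `|ξ|` on a neighbourhood of the annulus. -/
theorem exists_kernel_abs (hψ : LPfun ψ) : ∃ K, ∃ m : Vd 2 → ℝ, HasSymbol K m ∧
    (∀ ξ, m (fun i => -ξ i) = m ξ) ∧ ∀ ξ, annulus ψ ξ ≠ 0 → m ξ = eNorm ξ := by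
  let h : Vd 2 → ℝ := fun ξ => ψ (fun i => 1 / 2 * ξ i) - ψ (fun i => 3 * ξ i)
  have hs : ContDiff ℝ (⊤ : ℕ∞) h := (hψ.smooth_smul _).sub (hψ.smooth_smul _)
  have h0 : ∀ ξ, eNorm ξ ≤ 1 / 3 → h ξ = 0 := fun ξ hξ => by
    simp only [h]
    rw [hψ.eq_one_smul, hψ.eq_one_smul, sub_self]
    · rw [abs_of_pos (by norm_num)]; linarith
    · rw [abs_of_pos (by norm_num)]; linarith
  obtain ⟨K, hK⟩ := exists_schwartz_kernel _ (contDiff_eNorm_mul hs (by norm_num) h0)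
    (hasCompactSupport_of_eNorm 3 fun ξ hξ => by
      simp only [h]
      rw [hψ.eq_zero_smul, hψ.eq_zero_smul, sub_self, mul_zero]
      · rw [abs_of_pos (by norm_num)]; linarith
      · rw [abs_of_pos (by norm_num)]; linarith)
  refine ⟨K, _, hK, fun ξ => ?_, fun ξ hξ => ?_⟩
  · have hn : eNorm (fun i => -ξ i) = eNorm ξ := by simp [eNorm]
    simp only [h]
    rw [hn, hψ.radial (fun i => 1 / 2 * -ξ i) (fun i => 1 / 2 * ξ i) (by simp [eNorm]),
      hψ.radial (fun i => 3 * -ξ i) (fun i => 3 * ξ i) (by simp [eNorm])]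
  · have h1 : 1 / 2 < eNorm ξ := by
      by_contra hcon
      exact hξ (annulus_eq_zero_of_le hψ (not_lt.mp hcon))
    have h2 : eNorm ξ < 3 / 2 := by
      by_contra hcon
      exact hξ (annulus_eq_zero_of_ge hψ (not_lt.mp hcon))
    simp only [h]
    rw [hψ.eq_one_smul, hψ.eq_zero_smul, sub_zero, mul_one]
    · rw [abs_of_pos (by norm_num)]; linarith
    · rw [abs_of_pos (by norm_num)]; linarith

end Symbols

section Blocks

variable {ψ : Vd 2 → ℝ}

theorem eNorm_dyadic (n : ℕ) (k : Fin 2 → ℤ) :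
    eNorm (fun i => ((2:ℝ) ^ n)⁻¹ * (k i : ℝ)) = kAbs k / 2 ^ n := by
  rw [eNorm_smul, abs_of_pos (by positivity), kAbs, inv_mul_eq_div]

theorem kAbs_le_of_annulus_ne_zero (hψ : LPfun ψ) {n : ℕ} {k : Fin 2 → ℤ}
    (h : annulus ψ (fun i => ((2:ℝ) ^ n)⁻¹ * (k i : ℝ)) ≠ 0) : kAbs k ≤ 2 * 2 ^ n := by
  by_contra hk
  refine h (annulus_eq_zero_of_ge hψ ?_)
  rw [eNorm_dyadic, le_div_iff₀ (by positivity)]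
  nlinarith [pow_pos (zero_lt_two' ℝ) n]

theorem LPblock_natCast (hψ : LPfun ψ) (n : ℕ) (F : Vd 2 → ℂ) :
    LPblock ψ n F = fun x => ∑ k ∈ freqBall 2 (2 * 2 ^ n),
      (annulus ψ (fun i => ((2:ℝ) ^ n)⁻¹ * k i) : ℂ) * fCoeff F k * expZ k x := by
  have hsym : ∀ k : Fin 2 → ℤ, ψ (fun i => (k i : ℝ) / 2 ^ (n : ℤ))
      - ψ (fun i => (k i : ℝ) / 2 ^ ((n : ℤ) - 1))
        = annulus ψ (fun i => ((2:ℝ) ^ n)⁻¹ * k i) := by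
    intro k
    rw [annulus]
    congr 2 <;> ext i
    · rw [zpow_natCast, inv_mul_eq_div]
    · rw [zpow_sub_one₀ two_ne_zero, zpow_natCast]; field_simp
  ext x
  rw [LPblock, if_neg (by lia), if_neg (by lia)]
  simp only [hsym]
  refine tsum_eq_sum fun k hk => ?_
  have : annulus ψ (fun i => ((2:ℝ) ^ n)⁻¹ * k i) = 0 := by
    by_contra h
    exact hk (mem_freqBall.mpr (kAbs_le_of_annulus_ne_zero hψ h))
  simp [this]

theorem LPblock_mem_trigPoly (hψ : LPfun ψ) (n : ℕ) (F : Vd 2 → ℂ) :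
    LPblock ψ n F ∈ trigPoly 2 (2 * 2 ^ n) := by
  rw [LPblock_natCast hψ]
  exact sum_mem_trigPoly (fun k hk => mem_freqBall.mp hk) _

theorem LPlow_eq_sum (hψ : LPfun ψ) {j : ℤ} (hj : -1 ≤ j) {R : ℝ} (hR : 3 / 2 * 2 ^ j ≤ R)
    (F : Vd 2 → ℂ) (x : Vd 2) :
    LPlow ψ j F x = ∑ k ∈ freqBall 2 R,
      (ψ (fun i => (k i : ℝ) / 2 ^ j) : ℂ) * fCoeff F k * expZ k x := by
  have hdiv : ∀ k : Fin 2 → ℤ, 3 / 2 * 2 ^ j ≤ kAbs k → ψ (fun i => (k i : ℝ) / 2 ^ j) = 0 := by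
    intro k hk
    have : (fun i => (k i : ℝ) / 2 ^ j) = fun i => ((2:ℝ) ^ j)⁻¹ * (k i : ℝ) := by
      ext i; rw [inv_mul_eq_div]
    rw [this]
    refine hψ.eq_zero_smul (ξ := fun i => (k i : ℝ)) ?_
    rw [abs_of_pos (by positivity), inv_mul_eq_div, le_div_iff₀ (by positivity)]
    exact hk
  rw [LPlow, if_neg (by lia)]
  split_ifs with h
  · subst h
    rw [Finset.sum_eq_single 0]
    · have : ψ (fun i => ((0 : Fin 2 → ℤ) i : ℝ) / 2 ^ (-1 : ℤ)) = 1 :=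
        hψ.one _ (by simp [eNorm])
      rw [this, expZ_zero]
      simp
    · intro k _ hk
      rw [hdiv k]
      · simp
      · have := one_le_kAbs hk
        norm_num
        linarith
    · intro h0
      refine absurd (mem_freqBall.mpr ?_) h0
      rw [kAbs_zero]
      exact le_trans (by positivity) hR
  · refine tsum_eq_sum fun k hk => ?_
    rw [mem_freqBall, not_le] at hk
    rw [hdiv k (hR.trans hk.le)]
    simp

theorem LPlow_sub_LPlow (hψ : LPfun ψ) (n : ℕ) (F : Vd 2 → ℂ) (x : Vd 2) :
    LPlow ψ n F x - LPlow ψ (n - 1) F x = LPblock ψ n F x := by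
  have hp : (0:ℝ) < 2 ^ n := by positivity
  rw [LPlow_eq_sum hψ (R := 2 * 2 ^ n) (by lia) (by rw [zpow_natCast]; linarith),
    LPlow_eq_sum hψ (R := 2 * 2 ^ n) (by lia)
      (by rw [zpow_sub_one₀ two_ne_zero, zpow_natCast]; linarith),
    LPblock_natCast hψ, ← Finset.sum_sub_distrib]
  refine Finset.sum_congr rfl fun k _ => ?_
  rw [← sub_mul, ← sub_mul, annulus]
  push_cast
  congr 5 <;> ext i
  · rw [zpow_natCast, inv_mul_eq_div]
  · rw [zpow_sub_one₀ two_ne_zero, zpow_natCast]; field_simp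

/-- Littlewood–Paley blocks of an `α`-Hölder function decay like `2^{-nα}`. -/
theorem exists_norm_LPblock_le (hψ : LPfun ψ) : ∃ C > 0, ∀ (α : ℝ), 0 < α → α ≤ 1 →
    ∀ (F : Vd 2 → ℂ) (H : ℝ), 0 ≤ H → Continuous F → TorusFun F →
      (∀ x y, ‖F x - F y‖ ≤ H * ‖x - y‖ ^ α) → ∀ (n : ℕ) (x : Vd 2),
        ‖LPblock ψ n F x‖ ≤ C * H * (((2:ℝ) ^ n)⁻¹) ^ α := by
  obtain ⟨K, hK⟩ := exists_kernel_annulus hψ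
  have hI : Integrable fun z => ‖K z‖ * (1 + ‖z‖) := by
    have h := K.integrable.norm.add (K.integrable_pow_mul volume 1)
    refine h.congr (Filter.Eventually.of_forall fun z => ?_)
    simp only [Pi.add_apply, pow_one]; ring
  have hI0 : 0 ≤ ∫ z, ‖K z‖ * (1 + ‖z‖) := integral_nonneg fun z => by positivity
  refine ⟨(∫ z, ‖K z‖ * (1 + ‖z‖)) + 1, by positivity, fun α hα0 hα1 F H hH hc hF hHol n x => ?_⟩
  set ε : ℝ := ((2:ℝ) ^ n)⁻¹ with hε
  have hε0 : 0 < ε := by positivity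
  obtain ⟨B, hB⟩ := exists_norm_le hc hF
  have h0 : ∫ z, K z = 0 := by
    have := hK 0
    rw [annulus_eq_zero_of_le hψ (by simp [eNorm])] at this
    simpa using this
  have h1 : LPblock ψ n F x = ∫ z, K z * (F (x - ε • z) - F x) := by
    rw [LPblock_natCast hψ]
    dsimp only
    rw [sum_fCoeff_eq_scaledConv hK
      (fun k hk => mem_freqBall.mpr (kAbs_le_of_annulus_ne_zero hψ hk)) hc hF, scaledConv]
    simp only [mul_sub]
    rw [integral_sub (integrable_kernel_mul K (by fun_prop) fun _ => hB _)
      (K.integrable.mul_const _), integral_mul_const, h0, zero_mul, sub_zero]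
  rw [h1]
  have h2 : ‖∫ z, K z * (F (x - ε • z) - F x)‖ ≤ ∫ z, (‖K z‖ * (1 + ‖z‖)) * (H * ε ^ α) := by
    refine norm_integral_le_of_norm_le (hI.mul_const _) (Filter.Eventually.of_forall fun z => ?_)
    rw [norm_mul, mul_assoc]
    refine mul_le_mul_of_nonneg_left ?_ (norm_nonneg _)
    refine (hHol _ _).trans ?_
    have e : ‖x - ε • z - x‖ = ε * ‖z‖ := by
      rw [sub_sub_cancel_left, norm_neg, norm_smul, Real.norm_of_nonneg hε0.le]
    rw [e, Real.mul_rpow hε0.le (norm_nonneg z)]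
    have h3 : ‖z‖ ^ α ≤ 1 + ‖z‖ := by
      rcases le_total ‖z‖ 1 with h | h
      · exact (Real.rpow_le_one (norm_nonneg _) h hα0.le).trans (by linarith [norm_nonneg z])
      · exact (Real.rpow_le_rpow_of_exponent_le h hα1).trans (by rw [Real.rpow_one]; linarith)
    have h4 : 0 ≤ ε ^ α := by positivity
    nlinarith [mul_le_mul_of_nonneg_left h3 (mul_nonneg hH h4)]
  rw [integral_mul_const] at h2
  refine h2.trans ?_
  rw [mul_assoc]
  exact mul_le_mul_of_nonneg_right (by linarith) (by positivity)

end Blocks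

section Commutator

variable {ψ : Vd 2 → ℝ}

theorem Lam1_LPblock (hψ : LPfun ψ) {K : 𝓢(Vd 2, ℂ)} {m : Vd 2 → ℝ} (hK : HasSymbol K m)
    (hm : ∀ ξ, annulus ψ ξ ≠ 0 → m ξ = eNorm ξ) (n : ℕ) (F : Vd 2 → ℂ) (x : Vd 2) :
    Lam1 (LPblock ψ n F) x = 2 ^ n * scaledConv K ((2:ℝ) ^ n)⁻¹ (LPblock ψ n F) x := by
  rw [LPblock_natCast hψ, Lam1, LamPow, fmul_sum, scaledConv_sum hK, Finset.mul_sum]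
  refine Finset.sum_congr rfl fun k _ => ?_
  by_cases h : annulus ψ (fun i => ((2:ℝ) ^ n)⁻¹ * k i) = 0
  · simp [h]
  rw [hm _ h, eNorm_dyadic, Real.rpow_one]
  have : (if k = 0 then (0:ℂ) else ((kAbs k : ℝ) : ℂ)) = ((kAbs k : ℝ) : ℂ) := by
    split_ifs with hk
    · simp [hk, kAbs_zero]
    · rfl
  rw [this]
  push_cast
  field_simp

theorem scaledConv_neg_LPblock (hψ : LPfun ψ) {K : 𝓢(Vd 2, ℂ)} {m : Vd 2 → ℝ}
    (hK : HasSymbol K m) (hm : ∀ ξ, m (fun i => -ξ i) = m ξ) (ε : ℝ) (n : ℕ) (F : Vd 2 → ℂ)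
    (x : Vd 2) :
    scaledConv K (-ε) (LPblock ψ n F) x = scaledConv K ε (LPblock ψ n F) x := by
  rw [LPblock_natCast hψ, scaledConv_sum hK, scaledConv_sum hK]
  refine Finset.sum_congr rfl fun k _ => ?_
  rw [← hm fun i => ε * k i]
  simp only [neg_mul]

/-- The function `(Λf)g - f(Λg)` under the outer inverse in `Tbil`. -/
def lamCommutator (f g : Vd 2 → ℂ) : Vd 2 → ℂ := fun x => Lam1 f x * g x - f x * Lam1 g x

theorem lamCommutator_mem_trigPoly {R R' : ℝ} {f g : Vd 2 → ℂ} (hf : f ∈ trigPoly 2 R)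
    (hg : g ∈ trigPoly 2 R') : lamCommutator f g ∈ trigPoly 2 (R + R') :=
  Submodule.sub_mem _ (mul_mem_trigPoly (fmul_mem_trigPoly _ hf) hg)
    (mul_mem_trigPoly hf (fmul_mem_trigPoly _ hg))

theorem norm_mul_le_of_bounds {f g : Vd 2 → ℂ} {A B : ℝ} (hA : ∀ x, ‖f x‖ ≤ A)
    (hB : ∀ x, ‖g x‖ ≤ B) (x y : Vd 2) : ‖f x * g y‖ ≤ A * B := by
  rw [norm_mul]
  exact mul_le_mul (hA x) (hB y) (norm_nonneg _) ((norm_nonneg _).trans (hA x))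

/-- On a single dyadic shell `(Λf)g - f(Λg)` is an average of increments of the products
`y ↦ f y * g (y + 2⁻ⁿ z)`. -/
theorem lamCommutator_LPblock (hψ : LPfun ψ) {K : 𝓢(Vd 2, ℂ)} {m : Vd 2 → ℝ} (hK : HasSymbol K m)
    (heven : ∀ ξ, m (fun i => -ξ i) = m ξ) (hm : ∀ ξ, annulus ψ ξ ≠ 0 → m ξ = eNorm ξ) (n : ℕ)
    (F G : Vd 2 → ℂ) (x : Vd 2) :
    lamCommutator (LPblock ψ n F) (LPblock ψ n G) x = 2 ^ n * ∫ z, K z *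
      (LPblock ψ n F (x - ((2:ℝ) ^ n)⁻¹ • z) * LPblock ψ n G x
        - LPblock ψ n F x * LPblock ψ n G (x + ((2:ℝ) ^ n)⁻¹ • z)) := by
  rw [lamCommutator, Lam1_LPblock hψ hK hm, Lam1_LPblock hψ hK hm,
    ← scaledConv_neg_LPblock hψ hK heven _ n G, scaledConv, scaledConv]
  have hf := LPblock_mem_trigPoly hψ n F
  have hg := LPblock_mem_trigPoly hψ n G
  set f := LPblock ψ n F
  set g := LPblock ψ n G
  have hfc := continuous_of_mem_trigPoly hf
  have hgc := continuous_of_mem_trigPoly hg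
  obtain ⟨A, hA⟩ := exists_norm_le hfc (torusFun_of_mem_trigPoly hf)
  obtain ⟨B, hB⟩ := exists_norm_le hgc (torusFun_of_mem_trigPoly hg)
  simp only [mul_sub]
  rw [integral_sub
    (integrable_kernel_mul K (by fun_prop) fun _ => norm_mul_le_of_bounds hA hB _ _)
    (integrable_kernel_mul K (by fun_prop) fun _ => norm_mul_le_of_bounds hA hB _ _),
    mul_sub]
  simp only [neg_smul, sub_neg_eq_add]
  congr 1
  · rw [mul_assoc, ← integral_mul_const]
    simp only [mul_assoc]
  · rw [mul_left_comm, ← integral_const_mul (f x)]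
    simp only [mul_left_comm (f x)]

theorem exists_norm_scaledConv_lamCommutator_le (hψ : LPfun ψ) (L : 𝓢(Vd 2, ℂ)) :
    ∃ C > 0, ∀ (n l : ℕ) (F G : Vd 2 → ℂ) (A B : ℝ), (∀ x, ‖LPblock ψ n F x‖ ≤ A) →
      (∀ x, ‖LPblock ψ n G x‖ ≤ B) → ∀ x,
        ‖scaledConv L ((2:ℝ) ^ l)⁻¹ (lamCommutator (LPblock ψ n F) (LPblock ψ n G)) x‖
          ≤ C * 2 ^ l * (A * B) := by
  obtain ⟨K, m, hK, heven, hm⟩ := exists_kernel_abs hψ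
  have hI : Integrable fun z => ‖K z‖ * ‖z‖ := by
    simpa [mul_comm] using K.integrable_pow_mul volume 1
  set CK := ∫ z, ‖K z‖ * ‖z‖ with hCK
  set CL := ∫ z, ‖fderiv ℝ L z‖ with hCL
  have hCK0 : 0 ≤ CK := integral_nonneg fun z => by positivity
  have hCL0 : 0 ≤ CL := integral_nonneg fun z => by positivity
  refine ⟨CK * CL + 1, by positivity, fun n l F G A B hA hB x => ?_⟩
  set ε : ℝ := ((2:ℝ) ^ n)⁻¹ with hε
  set δ : ℝ := ((2:ℝ) ^ l)⁻¹ with hδ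
  have hε0 : 0 < ε := by positivity
  have hδ0 : 0 < δ := by positivity
  have hfc := continuous_of_mem_trigPoly (LPblock_mem_trigPoly hψ n F)
  have hgc := continuous_of_mem_trigPoly (LPblock_mem_trigPoly hψ n G)
  have hAB0 : 0 ≤ A * B := (norm_nonneg _).trans (norm_mul_le_of_bounds hA hB x x)
  let P : Vd 2 → Vd 2 → ℂ := fun z y => LPblock ψ n F y * LPblock ψ n G (y + ε • z)
  have hPc : ∀ z, Continuous (P z) := fun z => by fun_prop
  have hPB : ∀ z y, ‖P z y‖ ≤ A * B := fun z y => norm_mul_le_of_bounds hA hB _ _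
  have hcomm : ∀ y, lamCommutator (LPblock ψ n F) (LPblock ψ n G) y
      = 2 ^ n * ∫ z, K z * (P z (y - ε • z) - P z y) := by
    intro y
    rw [lamCommutator_LPblock hψ hK heven hm]
    simp only [P, sub_add_cancel]
    rfl
  have hswap : scaledConv L δ (lamCommutator (LPblock ψ n F) (LPblock ψ n G)) x
      = 2 ^ n * ∫ z, K z * (scaledConv L δ (P z) (x + -(ε • z)) - scaledConv L δ (P z) x) := by
    have hint : Integrable (Function.uncurry fun y z =>
        L y * (K z * (P z (x - δ • y - ε • z) - P z (x - δ • y))))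
        ((volume : Measure (Vd 2)).prod volume) := by
      have h1 : Integrable (fun p : Vd 2 × Vd 2 => L p.1 * K p.2)
          ((volume : Measure (Vd 2)).prod volume) := L.integrable.mul_prod K.integrable
      have h2 := h1.mul_bdd (c := A * B + A * B)
        (g := fun p => P p.2 (x - δ • p.1 - ε • p.2) - P p.2 (x - δ • p.1))
        (Continuous.aestronglyMeasurable (by fun_prop))
        (Filter.Eventually.of_forall fun p => (norm_sub_le _ _).trans
          (add_le_add (hPB _ _) (hPB _ _)))
      refine h2.congr (Filter.Eventually.of_forall fun p => ?_)
      simp only [Function.uncurry]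
      ring
    calc _ = 2 ^ n * ∫ y, ∫ z, L y * (K z * (P z (x - δ • y - ε • z) - P z (x - δ • y))) := by
          rw [scaledConv, ← integral_const_mul]
          congr 1; ext y
          rw [hcomm, integral_const_mul]
          ring
      _ = _ := by
          rw [integral_integral_swap hint]
          congr 1; congr 1; ext z
          have hc := hPc z
          rw [scaledConv, scaledConv, ← integral_sub
            (integrable_kernel_mul L (by fun_prop) fun _ => hPB z _)
            (integrable_kernel_mul L (by fun_prop) fun _ => hPB z _), ← integral_const_mul]
          congr 1; ext y
          have : x + -(ε • z) - δ • y = x - δ • y - ε • z := by abel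
          rw [this]
          ring
  have hbd : ‖∫ z, K z * (scaledConv L δ (P z) (x + -(ε • z)) - scaledConv L δ (P z) x)‖
      ≤ ∫ z, ‖K z‖ * ‖z‖ * (CL * (ε / δ) * (A * B)) := by
    refine norm_integral_le_of_norm_le (hI.mul_const _) (Filter.Eventually.of_forall fun z => ?_)
    rw [norm_mul, mul_assoc]
    refine mul_le_mul_of_nonneg_left ?_ (norm_nonneg _)
    refine (norm_scaledConv_add_sub_le L hδ0 (hPc z) (hPB z) x _).trans_eq ?_
    rw [norm_neg, norm_smul, Real.norm_of_nonneg hε0.le]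
    ring
  rw [integral_mul_const] at hbd
  rw [hswap, norm_mul, norm_pow, Complex.norm_ofNat]
  calc _ ≤ 2 ^ n * (CK * (CL * (ε / δ) * (A * B))) := by gcongr
    _ = CK * CL * 2 ^ l * (A * B) := by rw [hε, hδ]; field_simp
    _ ≤ _ := by gcongr; linarith

end Commutator

section ShellBounds

variable {ψ : Vd 2 → ℝ}

theorem sum_annulus_eq_one (hψ : LPfun ψ) {n : ℕ} {k : Fin 2 → ℤ} (hk : k ≠ 0)
    (hn : kAbs k ≤ 4 * 2 ^ n) :
    ∑ l ∈ Finset.range (n + 3), annulus ψ (fun i => ((2:ℝ) ^ l)⁻¹ * k i) = 1 := by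
  let u : ℕ → ℝ := fun l => ψ (fun i => 2 * (((2:ℝ) ^ l)⁻¹ * k i))
  have h2 : ∀ l, u (l + 1) = ψ (fun i => ((2:ℝ) ^ l)⁻¹ * k i) := fun l => by
    simp only [u]
    congr 1; ext i
    rw [pow_succ]
    field_simp
  have h1 : ∀ l, annulus ψ (fun i => ((2:ℝ) ^ l)⁻¹ * k i) = u (l + 1) - u l := fun l => by
    rw [h2]; rfl
  simp only [h1]
  rw [Finset.sum_range_sub, h2, hψ.eq_one_smul (ξ := fun i => (k i : ℝ))]
  · have : u 0 = 0 := by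
      simp only [u, pow_zero, inv_one, one_mul]
      refine hψ.eq_zero_smul (ξ := fun i => (k i : ℝ)) ?_
      have := one_le_kAbs hk
      rw [kAbs] at this
      rw [abs_two]
      linarith
    rw [this, sub_zero]
  · rw [abs_of_pos (by positivity), inv_mul_le_iff₀ (by positivity), mul_one]
    exact hn.trans_eq (by ring)

theorem LamPow_neg_one_eq_sum (hψ : LPfun ψ) {K : 𝓢(Vd 2, ℂ)}
    (hK : HasSymbol K fun ξ => annulus ψ ξ / eNorm ξ) {n : ℕ} {p : Vd 2 → ℂ}
    (hp : p ∈ trigPoly 2 (4 * 2 ^ n)) (x : Vd 2) :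
    LamPow (-1) p x = ∑ l ∈ Finset.range (n + 3),
      (((2:ℝ) ^ l)⁻¹ : ℂ) * scaledConv K ((2:ℝ) ^ l)⁻¹ p x := by
  obtain ⟨c, rfl⟩ := mem_trigPoly_iff.mp hp
  rw [LamPow, fmul_sum]
  simp only [scaledConv_sum hK, Finset.mul_sum]
  rw [Finset.sum_comm]
  refine Finset.sum_congr rfl fun k hk => ?_
  simp only [← mul_assoc]
  rw [← Finset.sum_mul, ← Finset.sum_mul]
  congr 2
  by_cases h : k = 0
  · rw [if_pos h]
    refine (Finset.sum_eq_zero fun l _ => ?_).symm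
    rw [annulus_eq_zero_of_le hψ]
    · simp
    · rw [eNorm_dyadic, h, kAbs_zero]; norm_num
  rw [if_neg h, Real.rpow_neg_one, ← one_div,
    ← sum_annulus_eq_one hψ h (mem_freqBall.mp hk), Finset.sum_div]
  push_cast
  refine Finset.sum_congr rfl fun l _ => ?_
  have : (kAbs k : ℂ) ≠ 0 := by
    exact_mod_cast (zero_lt_one.trans_le (one_le_kAbs h)).ne'
  rw [eNorm_dyadic]
  push_cast
  field_simp

theorem scaledConv_low_eq_self (hψ : LPfun ψ) {K : 𝓢(Vd 2, ℂ)}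
    (hK : HasSymbol K fun ξ => ψ (fun i => 1 / 4 * ξ i)) {n : ℕ} {p : Vd 2 → ℂ}
    (hp : p ∈ trigPoly 2 (4 * 2 ^ n)) : scaledConv K ((2:ℝ) ^ n)⁻¹ p = p := by
  obtain ⟨c, rfl⟩ := mem_trigPoly_iff.mp hp
  ext x
  rw [scaledConv_sum hK]
  refine Finset.sum_congr rfl fun k hk => ?_
  have hk' := mem_freqBall.mp hk
  rw [hψ.eq_one_smul]
  · simp
  · rw [eNorm_dyadic, abs_of_pos (by norm_num), one_div_mul_eq_div, div_div,
      div_le_one (by positivity)]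
    linarith

theorem Tbil_LPblock_mem_trigPoly (hψ : LPfun ψ) (n : ℕ) (F G : Vd 2 → ℂ) :
    Tbil (LPblock ψ n F) (LPblock ψ n G) ∈ trigPoly 2 (4 * 2 ^ n) := by
  refine fmul_mem_trigPoly _ ?_
  have := lamCommutator_mem_trigPoly (LPblock_mem_trigPoly hψ n F) (LPblock_mem_trigPoly hψ n G)
  exact trigPoly_mono (by linarith) this

theorem exists_norm_Tbil_LPblock_le (hψ : LPfun ψ) : ∃ C > 0, ∀ (n : ℕ) (F G : Vd 2 → ℂ)
    (A B : ℝ), (∀ x, ‖LPblock ψ n F x‖ ≤ A) → (∀ x, ‖LPblock ψ n G x‖ ≤ B) → ∀ x,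
      ‖Tbil (LPblock ψ n F) (LPblock ψ n G) x‖ ≤ C * (n + 3) * (A * B) := by
  obtain ⟨K, hK⟩ := exists_kernel_annulus_div hψ
  obtain ⟨C, hC, h⟩ := exists_norm_scaledConv_lamCommutator_le hψ K
  refine ⟨C, hC, fun n F G A B hA hB x => ?_⟩
  have hp : lamCommutator (LPblock ψ n F) (LPblock ψ n G) ∈ trigPoly 2 (4 * 2 ^ n) :=
    trigPoly_mono (by linarith)
      (lamCommutator_mem_trigPoly (LPblock_mem_trigPoly hψ n F) (LPblock_mem_trigPoly hψ n G))
  have hT : Tbil (LPblock ψ n F) (LPblock ψ n G) x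
      = LamPow (-1) (lamCommutator (LPblock ψ n F) (LPblock ψ n G)) x := rfl
  rw [hT, LamPow_neg_one_eq_sum hψ hK hp]
  have hterm : ∀ l ∈ Finset.range (n + 3), ‖(((2:ℝ) ^ l)⁻¹ : ℂ) * scaledConv K ((2:ℝ) ^ l)⁻¹
      (lamCommutator (LPblock ψ n F) (LPblock ψ n G)) x‖ ≤ C * (A * B) := fun l _ => by
    rw [norm_mul]
    have e : ‖(((2:ℝ) ^ l)⁻¹ : ℂ)‖ = ((2:ℝ) ^ l)⁻¹ := by simp
    rw [e, inv_mul_le_iff₀ (by positivity)]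
    exact (h n l F G A B hA hB x).trans_eq (by ring)
  refine (norm_sum_le_of_le _ hterm).trans_eq ?_
  rw [Finset.sum_const, Finset.card_range, nsmul_eq_mul]
  push_cast
  ring

theorem le_two_mul_rpow {D M t α : ℝ} (hM : 0 ≤ M) (ht : 0 ≤ t) (hα0 : 0 < α) (hα1 : α ≤ 1)
    (h1 : D ≤ 2 * M) (h2 : D ≤ M * t) : D ≤ 2 * M * t ^ α := by
  rcases le_total t 1 with h | h
  · have h3 : t ≤ t ^ α := Real.self_le_rpow_of_le_one ht h hα1
    have h4 : 0 ≤ t ^ α := by positivity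
    nlinarith [mul_le_mul_of_nonneg_left h3 hM, mul_nonneg hM h4]
  · have h3 : 1 ≤ t ^ α := Real.one_le_rpow h hα0.le
    nlinarith

theorem exists_norm_Tbil_LPblock_sub_le (hψ : LPfun ψ) : ∃ C > 0, ∀ (n : ℕ) (F G : Vd 2 → ℂ)
    (A B : ℝ), (∀ x, ‖LPblock ψ n F x‖ ≤ A) → (∀ x, ‖LPblock ψ n G x‖ ≤ B) →
      ∀ α : ℝ, 0 < α → α ≤ 1 → ∀ x y,
        ‖Tbil (LPblock ψ n F) (LPblock ψ n G) x - Tbil (LPblock ψ n F) (LPblock ψ n G) y‖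
          ≤ C * (n + 3) * (A * B) * (‖x - y‖ * 2 ^ n) ^ α := by
  obtain ⟨K, hK⟩ := exists_kernel_low hψ
  obtain ⟨C, hC, h⟩ := exists_norm_Tbil_LPblock_le hψ
  set D := ∫ z, ‖fderiv ℝ K z‖
  have hD : 0 ≤ D := integral_nonneg fun _ => norm_nonneg _
  refine ⟨2 * ((1 + D) * C), by positivity, fun n F G A B hA hB α hα0 hα1 x y => ?_⟩
  have hAB0 : 0 ≤ A * B := (norm_nonneg _).trans (norm_mul_le_of_bounds hA hB x x)
  have hT := Tbil_LPblock_mem_trigPoly hψ n F G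
  have hb := h n F G A B hA hB
  set T := Tbil (LPblock ψ n F) (LPblock ψ n G)
  set M := C * (n + 3) * (A * B) with hM
  have hM0 : 0 ≤ M := by positivity
  have h1 : ‖T x - T y‖ ≤ 2 * ((1 + D) * M) := by
    refine (norm_sub_le _ _).trans ?_
    nlinarith [hb x, hb y, mul_nonneg hD hM0]
  have h2 : ‖T x - T y‖ ≤ ((1 + D) * M) * (‖x - y‖ * 2 ^ n) := by
    have h3 := norm_scaledConv_add_sub_le K (ε := ((2:ℝ) ^ n)⁻¹) (by positivity)
      (continuous_of_mem_trigPoly hT) hb y (x - y)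
    rw [scaledConv_low_eq_self hψ hK hT, add_sub_cancel, div_inv_eq_mul] at h3
    have : 0 ≤ M * (‖x - y‖ * 2 ^ n) := by positivity
    nlinarith
  exact (le_two_mul_rpow (by positivity) (by positivity) hα0 hα1 h1 h2).trans_eq (by
    rw [hM]; ring)

/-- The dyadic pieces of the high–high interaction of two `α`-Hölder functions, and their
`α`-Hölder quotients, are bounded by `(n + 3) 2^{-nα}`. -/
theorem exists_Tbil_LPblock_holder (hψ : LPfun ψ) : ∃ C > 0, ∀ (α : ℝ), 0 < α → α ≤ 1 →
    ∀ (F G : Vd 2 → ℂ) (H H' : ℝ), 0 ≤ H → 0 ≤ H' → Continuous F → Continuous G →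
      TorusFun F → TorusFun G → (∀ x y, ‖F x - F y‖ ≤ H * ‖x - y‖ ^ α) →
      (∀ x y, ‖G x - G y‖ ≤ H' * ‖x - y‖ ^ α) → ∀ n : ℕ,
        (∀ x, ‖Tbil (LPblock ψ n F) (LPblock ψ n G) x‖
          ≤ C * (H * H') * ((n + 3) * ((2⁻¹:ℝ) ^ α) ^ n)) ∧
        ∀ x y, ‖Tbil (LPblock ψ n F) (LPblock ψ n G) x - Tbil (LPblock ψ n F) (LPblock ψ n G) y‖
          ≤ C * (H * H') * ((n + 3) * ((2⁻¹:ℝ) ^ α) ^ n) * ‖x - y‖ ^ α := by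
  obtain ⟨C₀, hC₀, h₀⟩ := exists_norm_LPblock_le hψ
  obtain ⟨C₁, hC₁, h₁⟩ := exists_norm_Tbil_LPblock_le hψ
  obtain ⟨C₂, hC₂, h₂⟩ := exists_norm_Tbil_LPblock_sub_le hψ
  refine ⟨(C₁ + C₂) * C₀ ^ 2, by positivity, fun α hα0 hα1 F G H H' hH hH' hFc hGc hF hG
    hFH hGH n => ?_⟩
  have hA := h₀ α hα0 hα1 F H hH hFc hF hFH n
  have hB := h₀ α hα0 hα1 G H' hH' hGc hG hGH n
  have hq : (((2:ℝ) ^ n)⁻¹) ^ α = ((2⁻¹:ℝ) ^ α) ^ n := by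
    rw [← inv_pow, ← Real.rpow_natCast, ← Real.rpow_natCast, ← Real.rpow_mul (by norm_num),
      ← Real.rpow_mul (by norm_num), mul_comm]
  have hq2 : ((2:ℝ) ^ n) ^ α * (((2:ℝ) ^ n)⁻¹) ^ α = 1 := by
    rw [← Real.mul_rpow (by positivity) (by positivity), mul_inv_cancel₀ (by positivity),
      Real.one_rpow]
  have hq1 : (((2:ℝ) ^ n)⁻¹) ^ α ≤ 1 :=
    Real.rpow_le_one (by positivity) (inv_le_one_of_one_le₀ (one_le_pow₀ one_le_two)) hα0.le
  rw [← hq]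
  set q := (((2:ℝ) ^ n)⁻¹) ^ α
  have hq0 : 0 ≤ q := by positivity
  refine ⟨fun x => (h₁ n F G _ _ hA hB x).trans ?_,
    fun x y => (h₂ n F G _ _ hA hB α hα0 hα1 x y).trans ?_⟩
  · calc _ = C₁ * C₀ ^ 2 * (H * H') * ((n + 3) * (q * q)) := by ring
      _ ≤ (C₁ + C₂) * C₀ ^ 2 * (H * H') * ((n + 3) * (q * 1)) := by gcongr; linarith
      _ = _ := by ring
  · rw [Real.mul_rpow (norm_nonneg _) (by positivity)]
    calc _ = C₂ * C₀ ^ 2 * (H * H') * ((n + 3) * q) * ‖x - y‖ ^ α * ((2 ^ n) ^ α * q) := by ring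
      _ ≤ _ := by rw [hq2, mul_one]; gcongr; linarith

end ShellBounds

section HolderNorm

theorem hSemi_nonneg {d : ℕ} {E : Type*} [NormedAddCommGroup E] (α : ℝ) (F : Vd d → E) : 0 ≤ hSemi α F :=
  Real.iSup_nonneg fun p => by split_ifs <;> positivity

variable {d : ℕ} {E : Type*} [NormedAddCommGroup E] [NormedSpace ℝ E] {F : Vd d → E} {α : ℝ}

theorem CkNorm_zero (F : Vd d → E) : CkNorm 0 F = ⨆ x, ‖F x‖ := by
  simp [CkNorm, norm_iteratedFDeriv_zero]

theorem hSemi_iteratedFDeriv_zero (α : ℝ) (F : Vd d → E) :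
    hSemi α (iteratedFDeriv ℝ 0 F) = hSemi α F := by
  unfold hSemi
  congr 1; ext p
  simp only [iteratedFDeriv_zero_eq_comp, Function.comp_apply, ← map_sub,
    LinearIsometryEquiv.norm_map]

theorem HolNorm_zero_eq (α : ℝ) (F : Vd d → E) :
    HolNorm 0 α F = (⨆ x, ‖F x‖) + hSemi α F := by
  rw [HolNorm, CkNorm_zero, hSemi_iteratedFDeriv_zero]

theorem HolNorm_zero_nonneg (α : ℝ) (F : Vd d → E) : 0 ≤ HolNorm 0 α F := by
  rw [HolNorm_zero_eq]
  exact add_nonneg (Real.iSup_nonneg fun _ => norm_nonneg _) (hSemi_nonneg _ _)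

theorem HolNorm_zero_le {B H : ℝ} (hB : 0 ≤ B) (hH : 0 ≤ H) (h1 : ∀ x, ‖F x‖ ≤ B)
    (h2 : ∀ x y, ‖F x - F y‖ ≤ H * ‖x - y‖ ^ α) : HolNorm 0 α F ≤ B + H := by
  rw [HolNorm_zero_eq]
  refine add_le_add (Real.iSup_le h1 hB) (Real.iSup_le (fun p => ?_) hH)
  split_ifs with h
  · exact hH
  · have : 0 < ‖p.1 - p.2‖ := norm_pos_iff.mpr (sub_ne_zero.mpr h)
    rw [div_le_iff₀ (by positivity)]
    exact h2 _ _

theorem torusFun_fderiv (hF : TorusFun F) : TorusFun (fderiv ℝ F) := fun x m => by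
  rw [← fderiv_comp_add_right (𝕜 := ℝ) (f := F) (x := x) (latt m)]
  congr 1
  ext y
  exact hF y m

theorem bddAbove_holderQuotient (hs : ContDiff ℝ (⊤ : ℕ∞) F) (hF : TorusFun F) (hα0 : 0 < α)
    (hα1 : α ≤ 1) : BddAbove (Set.range fun p : Vd d × Vd d =>
      if p.1 = p.2 then 0 else ‖F p.1 - F p.2‖ / ‖p.1 - p.2‖ ^ α) := by
  obtain ⟨B, hB⟩ := exists_norm_le hs.continuous hF
  obtain ⟨D, hD⟩ := exists_norm_le (hs.continuous_fderiv (by simp)) (torusFun_fderiv hF)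
  have hB0 : 0 ≤ B := (norm_nonneg _).trans (hB 0)
  have hD0 : 0 ≤ D := (norm_nonneg _).trans (hD 0)
  refine ⟨2 * (B + D), ?_⟩
  rintro _ ⟨p, rfl⟩
  dsimp only
  split_ifs with h
  · positivity
  have hp : 0 < ‖p.1 - p.2‖ := norm_pos_iff.mpr (sub_ne_zero.mpr h)
  rw [div_le_iff₀ (by positivity)]
  refine le_two_mul_rpow (by positivity) hp.le hα0 hα1 ?_ ?_
  · exact (norm_sub_le _ _).trans (by linarith [hB p.1, hB p.2])
  · refine (convex_univ.norm_image_sub_le_of_norm_fderiv_le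
      (fun x _ => (hs.differentiable (by simp)).differentiableAt) (fun x _ => hD x)
      (Set.mem_univ p.2) (Set.mem_univ p.1)).trans ?_
    gcongr
    linarith

theorem norm_sub_le_HolNorm (hs : ContDiff ℝ (⊤ : ℕ∞) F) (hF : TorusFun F) (hα0 : 0 < α)
    (hα1 : α ≤ 1) (x y : Vd d) : ‖F x - F y‖ ≤ HolNorm 0 α F * ‖x - y‖ ^ α := by
  rcases eq_or_ne x y with rfl | h
  · have := HolNorm_zero_nonneg α F
    rw [sub_self, norm_zero]
    positivity
  have hp : 0 < ‖x - y‖ := norm_pos_iff.mpr (sub_ne_zero.mpr h)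
  rw [← div_le_iff₀ (by positivity), HolNorm_zero_eq]
  have h1 := le_ciSup (bddAbove_holderQuotient hs hF hα0 hα1) (x, y)
  simp only [if_neg h] at h1
  exact h1.trans (le_add_of_nonneg_left (Real.iSup_nonneg fun _ => norm_nonneg _))

end HolderNorm

section HighHigh

variable {ψ : Vd 2 → ℝ}

theorem Lam1_const (c : ℂ) : Lam1 (fun _ : Vd 2 => c) = 0 := by
  have : (fun _ : Vd 2 => c) = fun x => ∑ k ∈ {0}, (fun _ => c) k * expZ k x := by
    ext x; simp [expZ_zero]
  rw [Lam1, LamPow, this, fmul_sum]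
  ext x; simp

theorem Tbil_const (c c' : ℂ) : Tbil (fun _ => c) (fun _ => c') = 0 := by
  have h : (fun _ : Vd 2 => (0:ℂ)) = 0 := rfl
  ext x
  simp [Tbil, Lam1_const, LamPow, fmul, h, fCoeff_zero]

theorem THH_one (hψ : LPfun ψ) (F G : Vd 2 → ℂ) (x : Vd 2) :
    THH ψ 1 F G x = ∑' n : ℕ, Tbil (LPblock ψ n F) (LPblock ψ n G) x := by
  rw [THH, ← Function.Injective.tsum_eq (g := ((↑) : ℕ → ℤ)) Nat.cast_injective]
  · refine tsum_congr fun n => ?_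
    congr 2
    ext y
    rw [add_sub_cancel_right, LPlow_sub_LPlow hψ]
  · intro j hj
    by_contra h
    have hj0 : j < 0 := by
      by_contra h0
      exact h ⟨j.toNat, Int.toNat_of_nonneg (not_lt.mp h0)⟩
    refine hj ?_
    have h1 : ∃ c, LPblock ψ j F = fun _ => c := by
      rcases lt_or_eq_of_le (show j ≤ -1 by lia) with h1 | h1
      · exact ⟨0, by rw [LPblock, if_pos h1]; rfl⟩
      · exact ⟨fCoeff F 0, by rw [LPblock, if_neg (by lia), if_pos h1]⟩
    have h2 : ∀ i ≤ (-1 : ℤ), ∃ c, LPlow ψ i G = fun _ => c := fun i hi => by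
      rcases lt_or_eq_of_le hi with h1 | h1
      · exact ⟨0, by rw [LPlow, if_pos h1]; rfl⟩
      · exact ⟨fCoeff G 0, by rw [LPlow, if_neg (by lia), if_pos h1]⟩
    obtain ⟨c, hc⟩ := h1
    obtain ⟨c₁, hc₁⟩ := h2 (j + 1 - 1) (by lia)
    obtain ⟨c₂, hc₂⟩ := h2 (j - 1) (by lia)
    simp only [hc, hc₁, hc₂, Tbil_const, Pi.zero_apply]

theorem summable_linear_mul_geometric {r : ℝ} (h0 : 0 ≤ r) (h1 : r < 1) :
    Summable fun n : ℕ => ((n:ℝ) + 3) * r ^ n := by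
  have hr : ‖r‖ < 1 := by rwa [Real.norm_of_nonneg h0]
  have h := (summable_pow_mul_geometric_of_norm_lt_one 1 hr).add
    ((summable_geometric_of_lt_one h0 h1).mul_left 3)
  exact h.congr fun n => by ring

/-- The high–high interaction of two `α`-Hölder functions is `α`-Hölder. -/
theorem exists_THH_holder (hψ : LPfun ψ) {α : ℝ} (hα0 : 0 < α) (hα1 : α ≤ 1) : ∃ C > 0,
    ∀ (F G : Vd 2 → ℂ) (H H' : ℝ), 0 ≤ H → 0 ≤ H' → Continuous F → Continuous G →
      TorusFun F → TorusFun G → (∀ x y, ‖F x - F y‖ ≤ H * ‖x - y‖ ^ α) →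
      (∀ x y, ‖G x - G y‖ ≤ H' * ‖x - y‖ ^ α) →
        Continuous (THH ψ 1 F G) ∧ TorusFun (THH ψ 1 F G) ∧
        (∀ x, ‖THH ψ 1 F G x‖ ≤ C * (H * H')) ∧
        ∀ x y, ‖THH ψ 1 F G x - THH ψ 1 F G y‖ ≤ C * (H * H') * ‖x - y‖ ^ α := by
  obtain ⟨C, hC, h⟩ := exists_Tbil_LPblock_holder hψ
  set r : ℝ := (2⁻¹:ℝ) ^ α with hr
  have hr0 : 0 < r := by positivity
  have hr1 : r < 1 := Real.rpow_lt_one (by norm_num) (by norm_num) hα0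
  have hw := summable_linear_mul_geometric hr0.le hr1
  set W := ∑' n : ℕ, ((n:ℝ) + 3) * r ^ n
  have hW : 0 < W := hw.tsum_pos (fun n => by positivity) 0 (by positivity)
  refine ⟨C * W, by positivity, fun F G H H' hH hH' hFc hGc hF hG hFH hGH => ?_⟩
  have hT := h α hα0 hα1 F G H H' hH hH' hFc hGc hF hG hFH hGH
  have hw' := hw.mul_left (C * (H * H'))
  have hval : ∑' n : ℕ, C * (H * H') * (((n:ℝ) + 3) * r ^ n) = C * W * (H * H') := by
    rw [tsum_mul_left]; ring
  have hsum : ∀ x, Summable fun n : ℕ => Tbil (LPblock ψ n F) (LPblock ψ n G) x := fun x =>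
    Summable.of_norm_bounded hw' fun n => (hT n).1 x
  have hp := fun n : ℕ => Tbil_LPblock_mem_trigPoly hψ n F G
  have hfun : THH ψ 1 F G = fun x => ∑' n : ℕ, Tbil (LPblock ψ n F) (LPblock ψ n G) x :=
    funext (THH_one hψ F G)
  rw [hfun]
  refine ⟨continuous_tsum (fun n => continuous_of_mem_trigPoly (hp n)) hw' fun n => (hT n).1,
    fun x m => ?_, fun x => ?_, fun x y => ?_⟩
  · exact tsum_congr fun n => torusFun_of_mem_trigPoly (hp n) x m
  · rw [← hval]
    exact tsum_of_norm_bounded hw'.hasSum fun n => (hT n).1 x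
  · rw [← (hsum x).tsum_sub (hsum y), ← hval]
    exact tsum_of_norm_bounded (hw'.hasSum.mul_right _) fun n => (hT n).2 x y

end HighHigh

end

/-- There is `j₀` such that the high–high part of
`T[f,g] = Λ^{-1}((Λf)g - f(Λg))` satisfies
`‖Δ_l T_{HH}[f,g]‖₀ ≲ 2^{-lα}‖f‖_α‖g‖_α` for every `l ∈ ℤ`, and hence
`‖T_{HH}[f,g]‖_α ≲ ‖f‖_α‖g‖_α`, with constants depending only on `α` (and `ψ`). -/
theorem paraproduct_HH_estimate (α : ℝ) (hα0 : 0 < α) (hα1 : α < 1)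
    (ψ : Vd 2 → ℝ) (hψ : LPfun ψ) :
    ∃ j₀ : ℤ, ∃ C > 0, ∀ f g : Vd 2 → ℝ,
      ContDiff ℝ (⊤ : ℕ∞) f → ContDiff ℝ (⊤ : ℕ∞) g → TorusFun f → TorusFun g →
      (∀ l : ℤ, CkNorm 0 (LPblock ψ l (THH ψ j₀ (cplx f) (cplx g)))
          ≤ C * (2:ℝ) ^ (-(l : ℝ) * α) * HolNorm 0 α f * HolNorm 0 α g) ∧
      HolNorm 0 α (THH ψ j₀ (cplx f) (cplx g)) ≤ C * HolNorm 0 α f * HolNorm 0 α g := by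
  obtain ⟨C₀, hC₀, h₀⟩ := exists_norm_LPblock_le hψ
  obtain ⟨C₁, hC₁, h₁⟩ := exists_THH_holder hψ hα0 hα1.le
  refine ⟨1, (C₀ + 2) * C₁, by positivity, fun f g hf hg hfT hgT => ?_⟩
  have hcont : ∀ {u : Vd 2 → ℝ}, ContDiff ℝ (⊤ : ℕ∞) u → Continuous (cplx u) := fun hu =>
    Complex.continuous_ofReal.comp hu.continuous
  have htor : ∀ {u : Vd 2 → ℝ}, TorusFun u → TorusFun (cplx u) := fun hu x m => by
    rw [cplx, hu, cplx]
  have hhol : ∀ {u : Vd 2 → ℝ}, ContDiff ℝ (⊤ : ℕ∞) u → TorusFun u → ∀ x y,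
      ‖cplx u x - cplx u y‖ ≤ HolNorm 0 α u * ‖x - y‖ ^ α := fun hu hT x y => by
    rw [cplx, cplx, ← Complex.ofReal_sub, Complex.norm_real]
    exact norm_sub_le_HolNorm hu hT hα0 hα1.le x y
  have hNf := HolNorm_zero_nonneg α f
  have hNg := HolNorm_zero_nonneg α g
  obtain ⟨hc, hT, hB, hH⟩ := h₁ (cplx f) (cplx g) _ _ hNf hNg (hcont hf) (hcont hg)
    (htor hfT) (htor hgT) (hhol hf hfT) (hhol hg hgT)
  set N := HolNorm 0 α f * HolNorm 0 α g with hN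
  have hN0 : 0 ≤ N := mul_nonneg hNf hNg
  simp only [mul_assoc _ (HolNorm 0 α f), ← hN]
  refine ⟨fun l => ?_, ?_⟩
  · have hpow : (0:ℝ) < 2 ^ (-(l : ℝ) * α) := by positivity
    rw [CkNorm_zero]
    refine Real.iSup_le (fun x => ?_) (by positivity)
    rcases lt_trichotomy l (-1) with hl | hl | hl
    · rw [LPblock, if_pos hl, Pi.zero_apply, norm_zero]
      positivity
    · rw [LPblock, if_neg (by lia), if_pos hl]
      have h1 : (1:ℝ) ≤ 2 ^ (-(l : ℝ) * α) := by
        refine Real.one_le_rpow one_le_two ?_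
        rw [hl]
        push_cast
        linarith
      calc _ ≤ C₁ * N := norm_fCoeff_le hB 0
        _ = 1 * C₁ * 1 * N := by ring
        _ ≤ _ := by gcongr; linarith
    · obtain ⟨n, rfl⟩ := Int.eq_ofNat_of_zero_le (show 0 ≤ l by lia)
      have e : (((2:ℝ) ^ n)⁻¹) ^ α = 2 ^ (-((n : ℤ) : ℝ) * α) := by
        rw [Real.rpow_mul (by norm_num), Real.rpow_neg (by norm_num), Int.cast_natCast,
          Real.rpow_natCast]
      calc _ ≤ C₀ * (C₁ * N) * (((2:ℝ) ^ n)⁻¹) ^ α :=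
            h₀ α hα0 hα1.le _ _ (by positivity) hc hT hH n x
        _ = C₀ * C₁ * 2 ^ (-((n : ℤ) : ℝ) * α) * N := by rw [e]; ring
        _ ≤ _ := by gcongr; linarith
  · calc _ ≤ C₁ * N + C₁ * N := HolNorm_zero_le (by positivity) (by positivity) hB hH
      _ = 2 * C₁ * N := by ring
      _ ≤ _ := by gcongr; linarith
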